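/- arXiv:1707.04965 — 2 statements merged into one kernel-verified Lean document; each statement's English description precedes it below -/
import Mathlib

section
/- There exists a constant C > 0 such that for every integer H ≥ 3, |#R_2(H) − 4H| ≤ C·H^(1/2), where #R_2(H) is the number of generalized degenerate monic integer polynomials of degree 2 and height at most H that are reducible over ℤ. -/
open Polynomial MeasureTheory

/-- A finite set of (nonzero) complex numbers is multiplicatively dependent:
there are integer exponents, not all zero, whose corresponding power product is 1. -/
def MulDep (S : Finset ℂ) : Prop :=
  ∃ k : ℂ → ℤ, (∃ z ∈ S, k z ≠ 0) ∧ ∏ z ∈ S, z ^ k z = 1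

/-- The distinct nonzero complex roots of an integer polynomial. -/
noncomputable def nzRoots (f : Polynomial ℤ) : Finset ℂ :=
  ((f.map (Int.castRingHom ℂ)).roots.toFinset).filter (fun z => z ≠ 0)

/-- A polynomial of degree at least 2 is generalized degenerate if its distinct
nonzero complex roots are multiplicatively dependent. -/
def GenDeg (f : Polynomial ℤ) : Prop :=
  2 ≤ f.natDegree ∧ MulDep (nzRoots f)

/-- Height (max absolute value of coefficients) at most `H`. -/
def HeightLe (f : Polynomial ℤ) (H : ℤ) : Prop :=
  ∀ i, |f.coeff i| ≤ H

def Iset (n : ℕ) (H : ℤ) : Set (Polynomial ℤ) :=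
  {f | f.Monic ∧ f.natDegree = n ∧ HeightLe f H ∧ Irreducible f ∧ GenDeg f}

def Rset (n : ℕ) (H : ℤ) : Set (Polynomial ℤ) :=
  {f | f.Monic ∧ f.natDegree = n ∧ HeightLe f H ∧ ¬ Irreducible f ∧ GenDeg f}

def Mset (n : ℕ) (H : ℤ) : Set (Polynomial ℤ) :=
  {f | f.Monic ∧ f.natDegree = n ∧ HeightLe f H ∧ GenDeg f}

def IstarSet (n : ℕ) (H : ℤ) : Set (Polynomial ℤ) :=
  {f | f.natDegree = n ∧ HeightLe f H ∧ Irreducible f ∧ GenDeg f}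

def RstarSet (n : ℕ) (H : ℤ) : Set (Polynomial ℤ) :=
  {f | f.natDegree = n ∧ HeightLe f H ∧ ¬ Irreducible f ∧ GenDeg f}

def MstarSet (n : ℕ) (H : ℤ) : Set (Polynomial ℤ) :=
  {f | f.natDegree = n ∧ HeightLe f H ∧ GenDeg f}

/-- `nu n` is the (n-1)-dimensional Lebesgue volume of the convex body
`|x_i| ≤ 1 (1 ≤ i ≤ n-1)`, `|x_1 + ⋯ + x_{n-1}| ≤ 1`. -/
noncomputable def nu (n : ℕ) : ℝ :=
  (volume {x : Fin (n - 1) → ℝ | (∀ i, |x i| ≤ 1) ∧ |∑ i, x i| ≤ 1}).toReal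

theorem exists_common_base {m n a b : ℕ} (hm : 2 ≤ m) (hn : 2 ≤ n) (ha : 0 < a) (hb : 0 < b)
    (h : m ^ a = n ^ b) : ∃ c i j, 0 < i ∧ 0 < j ∧ m = c ^ i ∧ n = c ^ j := by
  induction hN : m + n using Nat.strong_induction_on generalizing m n a b with
  | _ N ih =>
  subst hN
  have key : ∀ {m n a b : ℕ}, 2 ≤ m → m < n → 0 < b → m ^ a = n ^ b →
      ∃ n', 2 ≤ n' ∧ n = m * n' ∧ 0 < a - b ∧ m ^ (a - b) = n' ^ b := by
    intro m n a b hm hlt hb h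
    have hab : b < a := by
      by_contra! hab
      have h1 : m ^ a ≤ m ^ b := Nat.pow_le_pow_right (by omega) hab
      have h2 : m ^ b < n ^ b := Nat.pow_lt_pow_left hlt (by omega)
      omega
    have hdvd : m ∣ n := (Nat.pow_dvd_pow_iff (by omega : b ≠ 0)).1 (h ▸ pow_dvd_pow m hab.le)
    obtain ⟨n', rfl⟩ := hdvd
    refine ⟨n', by nlinarith, rfl, by omega, ?_⟩
    have hpos : 0 < m ^ b := by positivity
    apply Nat.eq_of_mul_eq_mul_left hpos
    rw [← pow_add, ← mul_pow, ← h]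
    congr 1
    omega
  rcases lt_trichotomy m n with hlt | rfl | hlt
  · obtain ⟨n', hn', rfl, hab, h'⟩ := key hm hlt hb h
    obtain ⟨c, i, j, hi, hj, h1, h2⟩ := ih (m + n') (by nlinarith) hm hn' hab hb h' rfl
    exact ⟨c, i, i + j, hi, by omega, h1, by rw [pow_add, ← h1, ← h2]⟩
  · exact ⟨m, 1, 1, by simp⟩
  · obtain ⟨m', hm', rfl, hab, h'⟩ := key hn hlt ha h.symm
    obtain ⟨c, i, j, hi, hj, h1, h2⟩ := ih (n + m') (by nlinarith) hn hm' hab ha h' rfl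
    exact ⟨c, i + j, i, by omega, hi, by rw [pow_add, ← h1, ← h2], h1⟩

theorem exists_pow_eq_pow_of_zpow_mul_zpow_eq_one {m n : ℕ} (hm : 2 ≤ m) (hn : 2 ≤ n) {k l : ℤ}
    (hkl : k ≠ 0 ∨ l ≠ 0) (h : (m : ℝ) ^ k * (n : ℝ) ^ l = 1) :
    ∃ a b : ℕ, 0 < a ∧ 0 < b ∧ m ^ a = n ^ b := by
  have hm1 : (1 : ℝ) < m := by exact_mod_cast hm
  have hn1 : (1 : ℝ) < n := by exact_mod_cast hn
  have hm0 : (m : ℝ) ≠ 0 := by positivity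
  have hn0 : (n : ℝ) ≠ 0 := by positivity
  have key : Real.log m * k + Real.log n * l = 0 := by
    have := congrArg Real.log h
    rw [Real.log_mul (zpow_ne_zero _ hm0) (zpow_ne_zero _ hn0), Real.log_zpow, Real.log_zpow,
      Real.log_one] at this
    linarith
  have hlm := Real.log_pos hm1
  have hln := Real.log_pos hn1
  rcases lt_trichotomy k 0 with hk | rfl | hk
  · have hl : 0 < l := by
      by_contra! hl
      have h1 : (k : ℝ) < 0 := by exact_mod_cast hk
      have h2 : (l : ℝ) ≤ 0 := by exact_mod_cast hl
      nlinarith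
    refine ⟨k.natAbs, l.natAbs, by omega, by omega, ?_⟩
    have h1 : k = -(k.natAbs : ℤ) := by omega
    have h2 : l = (l.natAbs : ℤ) := by omega
    rw [h1, h2, zpow_neg, zpow_natCast, zpow_natCast, inv_mul_eq_one₀ (pow_ne_zero _ hm0)] at h
    exact_mod_cast h
  · rw [Int.cast_zero, mul_zero, zero_add] at key
    rcases mul_eq_zero.1 key with h1 | h1
    · exact absurd h1 hln.ne'
    · exact absurd (Int.cast_eq_zero.1 h1) (by simpa using hkl)
  · have hl : l < 0 := by
      by_contra! hl
      have h1 : (0 : ℝ) < k := by exact_mod_cast hk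
      have h2 : (0 : ℝ) ≤ l := by exact_mod_cast hl
      nlinarith [mul_pos hlm h1, mul_nonneg hln.le h2]
    refine ⟨k.natAbs, l.natAbs, by omega, by omega, ?_⟩
    have h1 : k = (k.natAbs : ℤ) := by omega
    have h2 : l = -(l.natAbs : ℤ) := by omega
    rw [h1, h2, zpow_neg, zpow_natCast, zpow_natCast, mul_inv_eq_one₀ (pow_ne_zero _ hn0)] at h
    exact_mod_cast h

/-- The monic quadratic polynomial with integer roots `r` and `s`. -/
noncomputable def quad (r s : ℤ) : ℤ[X] := (X - C r) * (X - C s)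

theorem quad_comm (r s : ℤ) : quad r s = quad s r := mul_comm _ _

theorem quad_monic (r s : ℤ) : (quad r s).Monic := (monic_X_sub_C r).mul (monic_X_sub_C s)

theorem quad_natDegree (r s : ℤ) : (quad r s).natDegree = 2 := by
  rw [quad, (monic_X_sub_C r).natDegree_mul (monic_X_sub_C s),
    natDegree_X_sub_C, natDegree_X_sub_C]

theorem quad_eq (r s : ℤ) : quad r s = X ^ 2 + C (-(r + s)) * X + C (r * s) := by
  simp only [quad, C_neg, C_add, C_mul]
  ring

theorem quad_coeff_zero (r s : ℤ) : (quad r s).coeff 0 = r * s := by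
  simp [quad_eq]

theorem quad_coeff_one (r s : ℤ) : (quad r s).coeff 1 = -(r + s) := by
  rw [quad_eq, coeff_add, coeff_add, coeff_C_mul, coeff_X_one, coeff_X_pow, coeff_C]
  simp

theorem quad_not_irreducible (r s : ℤ) : ¬ Irreducible (quad r s) := by
  rw [(quad_monic r s).not_irreducible_iff_exists_add_mul_eq_coeff (quad_natDegree r s)]
  exact ⟨-r, -s, by rw [quad_coeff_zero]; ring, by rw [quad_coeff_one]; ring⟩

theorem quad_injective (r : ℤ) : Function.Injective (quad r) := by
  intro s t h
  have := mul_left_cancel₀ (X_sub_C_ne_zero r) h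
  simpa using this

theorem quad_heightLe {r s H : ℤ} (hH : 1 ≤ H) (h1 : |r + s| ≤ H) (h2 : |r * s| ≤ H) :
    HeightLe (quad r s) H := by
  intro i
  rcases i with _ | _ | _ | i
  · rwa [quad_coeff_zero]
  · rwa [zero_add, quad_coeff_one, abs_neg]
  · have h := quad_monic r s
    rw [Monic, leadingCoeff, quad_natDegree] at h
    simpa [h] using hH
  · rw [coeff_eq_zero_of_natDegree_lt (by rw [quad_natDegree]; omega)]
    simp
    omega

theorem exists_eq_quad {f : ℤ[X]} (hf : f.Monic) (hd : f.natDegree = 2) (hi : ¬ Irreducible f) :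
    ∃ r s, f = quad r s := by
  obtain ⟨c, d, h0, h1⟩ := (hf.not_irreducible_iff_exists_add_mul_eq_coeff hd).1 hi
  refine ⟨-c, -d, ?_⟩
  ext i
  rcases i with _ | _ | _ | i
  · rw [quad_coeff_zero, h0]; ring
  · rw [zero_add, quad_coeff_one, h1]; ring
  · have h := quad_monic (-c) (-d)
    rw [Monic, leadingCoeff, quad_natDegree] at h
    rw [Monic, leadingCoeff, hd] at hf
    exact hf.trans h.symm
  · rw [coeff_eq_zero_of_natDegree_lt (p := f) (by omega),
      coeff_eq_zero_of_natDegree_lt (by rw [quad_natDegree]; omega)]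

theorem nzRoots_quad (r s : ℤ) :
    nzRoots (quad r s) = ({(r : ℂ), (s : ℂ)} : Finset ℂ).filter (fun z => z ≠ 0) := by
  have h : (quad r s).map (Int.castRingHom ℂ) = (X - C (r : ℂ)) * (X - C (s : ℂ)) := by
    simp [quad]
  rw [nzRoots, h, roots_mul (mul_ne_zero (X_sub_C_ne_zero _) (X_sub_C_ne_zero _)),
    roots_X_sub_C, roots_X_sub_C]
  congr 1
  ext z
  simp

theorem mulDep_of_sq_eq_one {S : Finset ℂ} {z : ℂ} (hz : z ∈ S) (h : z ^ 2 = 1) : MulDep S := by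
  classical
  refine ⟨fun w => if w = z then 2 else 0, ⟨z, hz, by simp⟩, ?_⟩
  rw [Finset.prod_eq_single z]
  · beta_reduce
    rw [if_pos rfl]
    exact_mod_cast h
  · intro b _ hb
    simp [hb]
  · exact fun h' => absurd hz h'

theorem quad_genDeg {r s : ℤ} (hr : r ^ 2 = 1) : GenDeg (quad r s) := by
  refine ⟨(quad_natDegree r s).ge, mulDep_of_sq_eq_one (z := (r : ℂ)) ?_ (by exact_mod_cast hr)⟩
  rw [nzRoots_quad]
  have : r ≠ 0 := by rintro rfl; simp at hr
  simp [this]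

theorem not_mulDep_singleton {s : ℤ} (hs : 2 ≤ s.natAbs) : ¬ MulDep {(s : ℂ)} := by
  rintro ⟨k, ⟨z, hz, hk⟩, h⟩
  obtain rfl := Finset.mem_singleton.1 hz
  rw [Finset.prod_singleton] at h
  have h' := congrArg norm h
  rw [norm_zpow, norm_one] at h'
  have hn : 1 < ‖(s : ℂ)‖ := by
    rw [Complex.norm_intCast, ← Int.cast_abs, Int.abs_eq_natAbs]
    exact_mod_cast hs
  exact hk ((zpow_eq_one_iff_right₀ (by positivity) hn.ne').1 h')

theorem exists_common_base_of_genDeg {r s : ℤ} (hr : r.natAbs ≠ 1) (hs : s.natAbs ≠ 1)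
    (h : GenDeg (quad r s)) : 2 ≤ r.natAbs ∧ 2 ≤ s.natAbs ∧
      ∃ c i j, 0 < i ∧ 0 < j ∧ r.natAbs = c ^ i ∧ s.natAbs = c ^ j := by
  have hd := h.2
  rw [nzRoots_quad] at hd
  by_cases hr0 : r = 0
  · exfalso
    subst hr0
    by_cases hs0 : s = 0
    · subst hs0
      obtain ⟨k, ⟨z, hz, -⟩, -⟩ := hd
      simp at hz
    · refine not_mulDep_singleton (s := s) (by omega) ?_
      convert hd using 1
      ext z
      simp only [Finset.mem_singleton, Finset.mem_filter, Finset.mem_insert, Int.cast_zero]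
      constructor
      · rintro rfl
        simpa using hs0
      · tauto
  by_cases hs0 : s = 0
  · exfalso
    subst hs0
    refine not_mulDep_singleton (s := r) (by omega) ?_
    convert hd using 1
    ext z
    simp only [Finset.mem_singleton, Finset.mem_filter, Finset.mem_insert, Int.cast_zero]
    constructor
    · rintro rfl
      simpa using hr0
    · tauto
  have hr2 : 2 ≤ r.natAbs := by omega
  have hs2 : 2 ≤ s.natAbs := by omega
  refine ⟨hr2, hs2, ?_⟩
  by_cases hrs : r = s
  · exact ⟨r.natAbs, 1, 1, by simp [hrs]⟩
  have hS : ({(r : ℂ), (s : ℂ)} : Finset ℂ).filter (fun z => z ≠ 0) = {(r : ℂ), (s : ℂ)} := by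
    apply Finset.filter_true_of_mem
    simp [hr0, hs0]
  rw [hS] at hd
  obtain ⟨k, ⟨z, hz, hk⟩, hp⟩ := hd
  rw [Finset.prod_pair (by exact_mod_cast hrs)] at hp
  have hp' := congrArg norm hp
  rw [norm_mul, norm_zpow, norm_zpow, norm_one, Complex.norm_intCast, Complex.norm_intCast,
    ← Int.cast_abs, ← Int.cast_abs, Int.abs_eq_natAbs, Int.abs_eq_natAbs, Int.cast_natCast,
    Int.cast_natCast] at hp'
  have hkl : k r ≠ 0 ∨ k s ≠ 0 := by
    simp only [Finset.mem_insert, Finset.mem_singleton] at hz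
    rcases hz with rfl | rfl
    · exact Or.inl hk
    · exact Or.inr hk
  obtain ⟨a, b, ha, hb, hab⟩ := exists_pow_eq_pow_of_zpow_mul_zpow_eq_one hr2 hs2 hkl hp'
  exact exists_common_base hr2 hs2 ha hb hab

/-- Pairs of natural numbers covering the absolute values of the roots of those generalized
degenerate polynomials `(X - r) (X - s)` of height at most `N` for which `|r|, |s| ≥ 2`. -/
def powerPairs (N K : ℕ) : Finset (ℕ × ℕ) :=
  (Finset.range (N.sqrt + 1)).image (fun m => (m, m)) ∪
  (Finset.range (K + 1) ×ˢ Finset.range (Nat.log 2 N + 1) ×ˢ Finset.range (Nat.log 2 N + 1)).image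
    (fun t => (t.1 ^ t.2.1, t.1 ^ t.2.2))

theorem card_powerPairs_le (N K : ℕ) :
    (powerPairs N K).card ≤ (N.sqrt + 1) + (K + 1) * (Nat.log 2 N + 1) ^ 2 := by
  refine (Finset.card_union_le _ _).trans (add_le_add ?_ ?_)
  · exact Finset.card_image_le.trans (by simp)
  · exact Finset.card_image_le.trans (by simp [sq])

theorem mem_powerPairs {N K c i j : ℕ} (hK : ∀ c : ℕ, c ^ 3 ≤ N → c ≤ K) (hi : 0 < i) (hj : 0 < j)
    (hc : 2 ≤ c ^ i) (h : c ^ i * c ^ j ≤ N) : (c ^ i, c ^ j) ∈ powerPairs N K := by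
  have hc2 : 2 ≤ c := by
    by_contra! hlt
    have := Nat.pow_le_one_iff (n := i) (by omega) |>.2 (show c ≤ 1 by omega)
    omega
  rw [← pow_add] at h
  rw [powerPairs, Finset.mem_union, Finset.mem_image, Finset.mem_image]
  by_cases hij : i = j
  · subst hij
    refine Or.inl ⟨c ^ i, ?_, rfl⟩
    rw [Finset.mem_range, Nat.lt_succ_iff, Nat.le_sqrt, ← pow_add]
    exact h
  · refine Or.inr ⟨(c, i, j), ?_, rfl⟩
    have hN : 2 ^ (i + j) ≤ N := (Nat.pow_le_pow_left hc2 _).trans h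
    have hL : i + j ≤ Nat.log 2 N := Nat.le_log_of_pow_le (by norm_num) hN
    have hcK : c ≤ K := hK c ((Nat.pow_le_pow_right (by omega) (by omega)).trans h)
    simp only [Finset.mem_product, Finset.mem_range]
    omega

/-- The polynomials `(X - r) (X - s)` with `(|r|, |s|)` in a given set of pairs. -/
noncomputable def signedQuads (Q : Finset (ℕ × ℕ)) : Finset ℤ[X] :=
  (({1, -1} : Finset ℤ) ×ˢ ({1, -1} : Finset ℤ) ×ˢ Q).image
    (fun t => quad (t.1 * t.2.2.1) (t.2.1 * t.2.2.2))

theorem card_signedQuads_le (Q : Finset (ℕ × ℕ)) : (signedQuads Q).card ≤ 4 * Q.card := by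
  refine Finset.card_image_le.trans ?_
  rw [Finset.card_product, Finset.card_product, ← mul_assoc]
  rfl

theorem quad_mem_signedQuads {Q : Finset (ℕ × ℕ)} {r s : ℤ} (h : (r.natAbs, s.natAbs) ∈ Q) :
    quad r s ∈ signedQuads Q := by
  have sign : ∀ t : ℤ, ∃ e ∈ ({1, -1} : Finset ℤ), t = e * t.natAbs := by
    intro t
    rcases Int.natAbs_eq t with h | h
    · exact ⟨1, by simp, by omega⟩
    · exact ⟨-1, by simp, by omega⟩
  obtain ⟨d, hd, hr⟩ := sign r
  obtain ⟨e, he, hs⟩ := sign s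
  refine Finset.mem_image.2 ⟨(d, e, r.natAbs, s.natAbs), ?_, ?_⟩
  · exact Finset.mem_product.2 ⟨hd, Finset.mem_product.2 ⟨he, h⟩⟩
  · simp only [← hr, ← hs]

theorem Rset_two_subset {H : ℤ} {K : ℕ} (hK : ∀ c : ℕ, c ^ 3 ≤ H.toNat → c ≤ K) :
    Rset 2 H ⊆ ↑((Finset.Icc (-H) H).image (quad 1) ∪ (Finset.Icc (-H) H).image (quad (-1)) ∪
      signedQuads (powerPairs H.toNat K)) := by
  rintro f ⟨hm, hd, hh, hi, hg⟩
  obtain ⟨r, s, rfl⟩ := exists_eq_quad hm hd hi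
  have h0 : |r * s| ≤ H := quad_coeff_zero r s ▸ hh 0
  have unit_root : ∀ {r s : ℤ}, |r * s| ≤ H → r.natAbs = 1 →
      quad r s ∈ (Finset.Icc (-H) H).image (quad 1) ∪ (Finset.Icc (-H) H).image (quad (-1)) := by
    intro r s h hr
    have hs : s ∈ Finset.Icc (-H) H := by
      rw [abs_mul, Int.abs_eq_natAbs r, hr] at h
      rw [Finset.mem_Icc, ← abs_le]
      simpa using h
    rw [Finset.mem_union]
    rcases Int.natAbs_eq_iff.1 hr with rfl | rfl
    · exact Or.inl (Finset.mem_image_of_mem _ hs)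
    · exact Or.inr (Finset.mem_image_of_mem _ hs)
  rw [Finset.mem_coe, Finset.mem_union]
  by_cases hr : r.natAbs = 1
  · exact Or.inl (unit_root h0 hr)
  by_cases hs : s.natAbs = 1
  · exact Or.inl (quad_comm s r ▸ unit_root (mul_comm r s ▸ h0) hs)
  right
  obtain ⟨hr2, -, c, i, j, hi, hj, hrc, hsc⟩ := exists_common_base_of_genDeg hr hs hg
  apply quad_mem_signedQuads
  have hN : r.natAbs * s.natAbs ≤ H.toNat := by
    rw [← Int.natAbs_mul]
    rw [Int.abs_eq_natAbs] at h0
    omega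
  rw [hrc] at hr2
  rw [hrc, hsc] at hN ⊢
  exact mem_powerPairs hK hi hj hr2 hN

theorem subset_Rset_two {H : ℤ} (hH : 3 ≤ H) :
    ↑((Finset.Icc (-(H - 1)) (H - 1)).image (quad 1) ∪
      ((Finset.Icc (-(H - 1)) (H - 1)).erase 1).image (quad (-1))) ⊆ Rset 2 H := by
  intro f hf
  have key : ∀ {r s : ℤ}, r.natAbs = 1 → s ∈ Finset.Icc (-(H - 1)) (H - 1) →
      quad r s ∈ Rset 2 H := by
    intro r s hr hs
    rw [Finset.mem_Icc] at hs
    refine ⟨quad_monic r s, quad_natDegree r s, quad_heightLe (by omega) ?_ ?_,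
      quad_not_irreducible r s, quad_genDeg ?_⟩ <;>
    rcases Int.natAbs_eq_iff.1 hr with rfl | rfl <;> simp [abs_le] <;> omega
  rw [Finset.mem_coe, Finset.mem_union, Finset.mem_image, Finset.mem_image] at hf
  rcases hf with ⟨s, hs, rfl⟩ | ⟨s, hs, rfl⟩
  · exact key rfl hs
  · exact key rfl (Finset.mem_of_mem_erase hs)

theorem card_unit_root_quads {H : ℤ} (hH : 3 ≤ H) :
    (((Finset.Icc (-(H - 1)) (H - 1)).image (quad 1) ∪
      ((Finset.Icc (-(H - 1)) (H - 1)).erase 1).image (quad (-1))).card : ℤ) = 4 * H - 3 := by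
  rw [Finset.card_union_of_disjoint, Finset.card_image_of_injective _ (quad_injective _),
    Finset.card_image_of_injective _ (quad_injective _), Finset.card_erase_of_mem, Int.card_Icc]
  · omega
  · rw [Finset.mem_Icc]; omega
  · rw [Finset.disjoint_left]
    intro f h1 h2
    obtain ⟨s, -, rfl⟩ := Finset.mem_image.1 h1
    obtain ⟨t, ht, h⟩ := Finset.mem_image.1 h2
    have h' := congrArg (eval 1) h
    simp [quad] at h'
    exact Finset.ne_of_mem_erase ht (by omega)

theorem natLog_two_add_one_le {N : ℕ} (hN : 1 ≤ N) :
    ((Nat.log 2 N : ℕ) : ℝ) + 1 ≤ 25 * (N : ℝ) ^ (1 / 12 : ℝ) := by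
  have hN1 : (1 : ℝ) ≤ N := by exact_mod_cast hN
  have h1 : (Nat.log 2 N : ℝ) * Real.log 2 ≤ Real.log N := by
    rw [← Real.log_pow]
    apply Real.log_le_log (by positivity)
    exact_mod_cast Nat.pow_log_le_self 2 (by omega)
  have h2 := Real.log_le_rpow_div (x := (N : ℝ)) (ε := 1 / 12) (by positivity) (by norm_num)
  have h3 : (1 : ℝ) ≤ (N : ℝ) ^ (1 / 12 : ℝ) := Real.one_le_rpow hN1 (by norm_num)
  have h4 := Real.log_two_gt_d9
  have h5 : (0 : ℝ) ≤ Nat.log 2 N := by positivity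
  nlinarith

theorem card_powerPairs_floor_le {N : ℕ} (hN : 1 ≤ N) :
    ((powerPairs N ⌊(N : ℝ) ^ (1 / 3 : ℝ)⌋₊).card : ℝ) ≤ 1252 * Real.sqrt N := by
  have hN1 : (1 : ℝ) ≤ N := by exact_mod_cast hN
  have h1 : (1 : ℝ) ≤ Real.sqrt N := Real.one_le_sqrt.2 hN1
  have h2 : ((N.sqrt : ℕ) : ℝ) ≤ Real.sqrt N := Real.nat_sqrt_le_real_sqrt
  have h3 : (⌊(N : ℝ) ^ (1 / 3 : ℝ)⌋₊ : ℝ) + 1 ≤ 2 * (N : ℝ) ^ (1 / 3 : ℝ) := by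
    have := Nat.floor_le (a := (N : ℝ) ^ (1 / 3 : ℝ)) (by positivity)
    have := Real.one_le_rpow hN1 (show (0 : ℝ) ≤ 1 / 3 by norm_num)
    linarith
  have h4 := pow_le_pow_left₀ (by positivity) (natLog_two_add_one_le hN) 2
  have h5 := mul_le_mul h3 h4 (by positivity) (by positivity)
  have h6 : (2 * (N : ℝ) ^ (1 / 3 : ℝ)) * (25 * (N : ℝ) ^ (1 / 12 : ℝ)) ^ 2 =
      1250 * Real.sqrt N := by
    have : Real.sqrt N = (N : ℝ) ^ (1 / 3 : ℝ) * ((N : ℝ) ^ (1 / 12 : ℝ)) ^ 2 := by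
      rw [← Real.rpow_natCast, ← Real.rpow_mul (by positivity), ← Real.rpow_add (by positivity),
        Real.sqrt_eq_rpow]
      norm_num
    rw [this]
    ring
  have h7 : ((powerPairs N ⌊(N : ℝ) ^ (1 / 3 : ℝ)⌋₊).card : ℝ) ≤
      (N.sqrt + 1) + (⌊(N : ℝ) ^ (1 / 3 : ℝ)⌋₊ + 1) * (Nat.log 2 N + 1) ^ 2 := by
    exact_mod_cast card_powerPairs_le N _
  linarith

theorem le_floor_cube_root {N c : ℕ} (h : c ^ 3 ≤ N) : c ≤ ⌊(N : ℝ) ^ (1 / 3 : ℝ)⌋₊ := by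
  apply Nat.le_floor
  have h' : (c : ℝ) ^ 3 ≤ N := by exact_mod_cast h
  calc (c : ℝ) = ((c : ℝ) ^ 3) ^ (1 / 3 : ℝ) := by
        rw [← Real.rpow_natCast, ← Real.rpow_mul (by positivity)]
        norm_num
    _ ≤ _ := Real.rpow_le_rpow (by positivity) h' (by norm_num)

theorem stmt_4 :
    ∃ C : ℝ, 0 < C ∧ ∀ H : ℤ, 3 ≤ H →
      |((Rset 2 H).ncard : ℝ) - 4 * (H : ℝ)| ≤ C * Real.sqrt (H : ℝ) := by
  refine ⟨6000, by norm_num, fun H hH => ?_⟩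
  have hsub := Rset_two_subset (H := H) (fun c => le_floor_cube_root)
  have hcast : ((H.toNat : ℕ) : ℝ) = H := by
    exact_mod_cast Int.toNat_of_nonneg (show 0 ≤ H by omega)
  have hpairs := card_powerPairs_floor_le (N := H.toNat) (by omega)
  have hupper := Set.ncard_le_ncard hsub (Finset.finite_toSet _)
  have hlower := Set.ncard_le_ncard (subset_Rset_two hH) ((Finset.finite_toSet _).subset hsub)
  rw [Set.ncard_coe_finset] at hupper hlower
  have hlow : 4 * (H : ℝ) - 3 ≤ (Rset 2 H).ncard := by
    have := card_unit_root_quads hH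
    exact_mod_cast (show 4 * H - 3 ≤ ((Rset 2 H).ncard : ℤ) by omega)
  have hupp : ((Rset 2 H).ncard : ℝ) ≤
      4 * H + 2 + 4 * (powerPairs H.toNat ⌊(H.toNat : ℝ) ^ (1 / 3 : ℝ)⌋₊).card := by
    have hu : ∀ e : ℤ, ((Finset.Icc (-H) H).image (quad e)).card ≤ (2 * H + 1).toNat := by
      intro e
      refine Finset.card_image_le.trans ?_
      rw [Int.card_Icc]
      omega
    have h1 := hu 1
    have h2 := hu (-1)
    have h3 := card_signedQuads_le (powerPairs H.toNat ⌊(H.toNat : ℝ) ^ (1 / 3 : ℝ)⌋₊)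
    have h4 := hupper.trans (Finset.card_union_le _ _)
    have h5 := Finset.card_union_le ((Finset.Icc (-H) H).image (quad 1))
      ((Finset.Icc (-H) H).image (quad (-1)))
    exact_mod_cast (show ((Rset 2 H).ncard : ℤ) ≤
      4 * H + 2 + 4 * (powerPairs H.toNat ⌊(H.toNat : ℝ) ^ (1 / 3 : ℝ)⌋₊).card by omega)
  rw [hcast] at hpairs hupp
  have hone : 1 ≤ Real.sqrt (H : ℝ) := by
    rw [Real.one_le_sqrt]
    exact_mod_cast (show 1 ≤ H by omega)
  rw [abs_le]
  constructor <;> linarith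
end

section
/- There exists a constant C > 0 such that for every integer H ≥ 3, |#R_3(H) − 6H²| ≤ C·H·(log H)·(log log H), where #R_3(H) is the number of generalized degenerate monic integer polynomials of degree 3 and height at most H that are reducible over ℤ. -/
open Polynomial MeasureTheory

/-- The integer relation with exponents `l, m, n` holds between the prime valuations of the
natural numbers `X, Y, Z`. -/
def ValRel (X Y Z : ℕ) (l m n : ℤ) : Prop :=
  ∀ p : ℕ, l * (X.factorization p : ℤ) + m * (Y.factorization p : ℤ)
    + n * (Z.factorization p : ℤ) = 0

/-- Two natural numbers have linearly independent valuation vectors. -/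
def ValIndep (X Y : ℕ) : Prop := ∀ l m : ℤ, ValRel X Y 1 l m 0 → l = 0 ∧ m = 0

lemma valRel_of_zpow_mul_eq_one {x y z : ℤ} (hx : x ≠ 0) (hy : y ≠ 0) (hz : z ≠ 0)
    {l m n : ℤ} (h : (x : ℂ) ^ l * (y : ℂ) ^ m * (z : ℂ) ^ n = 1) :
    ValRel x.natAbs y.natAbs z.natAbs l m n := by
  have hq : (x : ℚ) ^ l * (y : ℚ) ^ m * (z : ℚ) ^ n = 1 := by
    apply Rat.cast_injective (α := ℂ)
    push_cast
    exact h
  have hx' : (x : ℚ) ≠ 0 := by exact_mod_cast hx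
  have hy' : (y : ℚ) ≠ 0 := by exact_mod_cast hy
  have hz' : (z : ℚ) ≠ 0 := by exact_mod_cast hz
  intro p
  by_cases hp : p.Prime
  · have := Fact.mk hp
    have h1 := congrArg (padicValRat p) hq
    rw [padicValRat.mul (mul_ne_zero (zpow_ne_zero _ hx') (zpow_ne_zero _ hy'))
      (zpow_ne_zero _ hz'), padicValRat.mul (zpow_ne_zero _ hx') (zpow_ne_zero _ hy'),
      padicValRat.zpow, padicValRat.zpow, padicValRat.zpow, padicValRat.one,
      padicValRat.of_int, padicValRat.of_int, padicValRat.of_int] at h1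
    simpa [padicValInt, Nat.factorization_def _ hp] using h1
  · simp [Nat.factorization_eq_zero_of_not_prime _ hp]

lemma exists_eq_pow_of_valRel {X Y : ℕ} (hX : 2 ≤ X) (hY : Y ≠ 0) {l m : ℤ}
    (hlm : ¬ (l = 0 ∧ m = 0)) (h : ValRel X Y 1 l m 0) :
    ∃ g i j : ℕ, 2 ≤ g ∧ 1 ≤ i ∧ X = g ^ i ∧ Y = g ^ j := by
  have hq : X.minFac.Prime := Nat.minFac_prime (by omega)
  set q := X.minFac with hqdef
  have hs : X.factorization q ≠ 0 :=
    (hq.factorization_pos_of_dvd (by omega) (Nat.minFac_dvd X)).ne'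
  set s := X.factorization q with hsdef
  set t := Y.factorization q with htdef
  have hm : m ≠ 0 := by
    rintro rfl
    have := h q
    simp only [zero_mul, add_zero, mul_eq_zero, Int.natCast_eq_zero] at this
    exact hlm ⟨this.resolve_right hs, rfl⟩
  have hpow : X ^ t = Y ^ s := by
    apply Nat.eq_of_factorization_eq (pow_ne_zero _ (by omega)) (pow_ne_zero _ hY)
    intro p
    simp only [Nat.factorization_pow, Finsupp.coe_smul, Pi.smul_apply, smul_eq_mul]
    have h1 := h p
    have h2 := h q
    have h3 : m * ((t * X.factorization p : ℕ) : ℤ) = m * ((s * Y.factorization p : ℕ) : ℤ) := by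
      push_cast
      linear_combination (X.factorization p : ℤ) * h2 - (s : ℤ) * h1
    exact_mod_cast mul_left_cancel₀ hm h3
  obtain ⟨g, hg1, hg2⟩ := Nat.exists_eq_pow_of_pow_eq_pow (Or.inr hs) hpow
  refine ⟨g, _, _, ?_, ?_, hg1, hg2⟩
  · by_contra hlt
    interval_cases g
    · rcases Nat.eq_zero_or_pos (s / Nat.gcd t s) with h0 | h0
      · rw [h0] at hg1; simp at hg1; omega
      · rw [zero_pow h0.ne'] at hg1; omega
    · simp at hg1; omega
  · by_contra hlt
    have h0 : s / Nat.gcd t s = 0 := Nat.lt_one_iff.1 (not_le.1 hlt)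
    rw [h0] at hg1; simp at hg1; omega

lemma exists_factorization_det_ne_zero {X Y : ℕ} (h : ValIndep X Y) :
    ∃ p q : ℕ, (X.factorization p : ℤ) * Y.factorization q
      - (X.factorization q : ℤ) * Y.factorization p ≠ 0 := by
  by_contra! hall
  have hY : ∀ q, Y.factorization q = 0 := by
    intro q
    have := (h (Y.factorization q) (-(X.factorization q : ℤ)) (fun p => by
      have := hall p q
      simp only [zero_mul, add_zero]
      linarith)).1
    exact_mod_cast this
  have := (h 0 1 (fun p => by simp [hY p])).2
  norm_num at this

/-- The integers `z` of absolute value at most `N` that are multiplicatively dependent on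
`X` and `Y` as far as valuations are concerned. -/
noncomputable def depSet (N X Y : ℕ) : Finset ℤ := by
  classical
  exact (Finset.Icc (-(N : ℤ)) N).filter
    (fun z => z ≠ 0 ∧ ∃ l m n : ℤ, n ≠ 0 ∧ ValRel X Y z.natAbs l m n)

lemma mem_depSet {N X Y : ℕ} {z : ℤ} :
    z ∈ depSet N X Y ↔ (-(N : ℤ) ≤ z ∧ z ≤ N) ∧ z ≠ 0 ∧
      ∃ l m n : ℤ, n ≠ 0 ∧ ValRel X Y z.natAbs l m n := by
  simp [depSet]

lemma factorization_le_log {N Z p : ℕ} (hZ : Z ≠ 0) (hZN : Z ≤ N) :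
    Z.factorization p ≤ Nat.log 2 N := by
  by_cases hp : p.Prime
  · apply Nat.le_log_of_pow_le (by norm_num)
    calc 2 ^ Z.factorization p ≤ p ^ Z.factorization p := Nat.pow_le_pow_left hp.two_le _
      _ ≤ Z := Nat.ordProj_le p hZ
      _ ≤ N := hZN
  · simp [Nat.factorization_eq_zero_of_not_prime _ hp]

lemma natAbs_eq_of_factorization_eq {X Y p q : ℕ} {z w : ℤ}
    (hpq : (X.factorization p : ℤ) * Y.factorization q
      - (X.factorization q : ℤ) * Y.factorization p ≠ 0)
    (hz : z ≠ 0) (hw : w ≠ 0)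
    (hzr : ∃ l m n : ℤ, n ≠ 0 ∧ ValRel X Y z.natAbs l m n)
    (hwr : ∃ l m n : ℤ, n ≠ 0 ∧ ValRel X Y w.natAbs l m n)
    (hp : z.natAbs.factorization p = w.natAbs.factorization p)
    (hq : z.natAbs.factorization q = w.natAbs.factorization q) : z.natAbs = w.natAbs := by
  obtain ⟨l, m, n, hn, h⟩ := hzr
  obtain ⟨l', m', n', hn', h'⟩ := hwr
  have key : ∀ r, (n' * l - n * l') * (X.factorization r : ℤ)
      + (n' * m - n * m') * (Y.factorization r : ℤ)
      + n * n' * ((z.natAbs.factorization r : ℤ) - w.natAbs.factorization r) = 0 := by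
    intro r
    linear_combination n' * h r - n * h' r
  have kp := key p
  have kq := key q
  rw [hp, sub_self, mul_zero, add_zero] at kp
  rw [hq, sub_self, mul_zero, add_zero] at kq
  have e1 : n' * l - n * l' = 0 := by
    apply (mul_eq_zero.1 _).resolve_right hpq
    linear_combination (Y.factorization q : ℤ) * kp - (Y.factorization p : ℤ) * kq
  have e2 : n' * m - n * m' = 0 := by
    apply (mul_eq_zero.1 _).resolve_right hpq
    linear_combination -(X.factorization q : ℤ) * kp + (X.factorization p : ℤ) * kq
  apply Nat.eq_of_factorization_eq (by simpa using hz) (by simpa using hw)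
  intro r
  have kr := key r
  rw [e1, e2, zero_mul, zero_mul, zero_add, zero_add] at kr
  have := (mul_eq_zero.1 kr).resolve_left (mul_ne_zero hn hn')
  omega

lemma card_depSet_le {N X Y : ℕ} (h : ValIndep X Y) :
    (depSet N X Y).card ≤ 2 * (Nat.log 2 N + 1) ^ 2 := by
  classical
  obtain ⟨p, q, hpq⟩ := exists_factorization_det_ne_zero h
  have hmem : ∀ z ∈ depSet N X Y, z.natAbs ≤ N ∧ z ≠ 0 ∧
      ∃ l m n : ℤ, n ≠ 0 ∧ ValRel X Y z.natAbs l m n := by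
    intro z hz
    rw [mem_depSet] at hz
    exact ⟨by omega, hz.2⟩
  have := Finset.card_le_card_of_injOn (s := depSet N X Y)
    (t := (Finset.univ : Finset Bool) ×ˢ
      (Finset.range (Nat.log 2 N + 1) ×ˢ Finset.range (Nat.log 2 N + 1)))
    (fun z => (decide (0 < z), z.natAbs.factorization p, z.natAbs.factorization q)) ?_ ?_
  · simpa [sq] using this
  · intro z hz
    obtain ⟨h1, h2, -⟩ := hmem z hz
    have h3 : z.natAbs ≠ 0 := by simpa using h2
    have := factorization_le_log (p := p) h3 h1
    have := factorization_le_log (p := q) h3 h1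
    simp only [Finset.coe_product, Set.mem_prod, Finset.mem_coe, Finset.mem_univ,
      Finset.mem_range, true_and]
    omega
  · intro z hz w hw hzw
    obtain ⟨h1, h2, h3⟩ := hmem z hz
    obtain ⟨h1', h2', h3'⟩ := hmem w hw
    simp only [Prod.mk.injEq, decide_eq_decide] at hzw
    have := natAbs_eq_of_factorization_eq hpq h2 h2' h3 h3' hzw.2.1 hzw.2.2
    omega

/-- The monic cubic `(X - a) (X² + b X + c)`. -/
noncomputable def cub (a b c : ℤ) : ℤ[X] := (X - C a) * (X ^ 2 + C b * X + C c)

/-- The monic cubic with roots `x, y, z`. -/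
noncomputable def tri (x y z : ℤ) : ℤ[X] := (X - C x) * (X - C y) * (X - C z)

lemma tri_eq_cub (x y z : ℤ) : tri x y z = cub x (-(y + z)) (y * z) := by
  simp only [tri, cub, C_neg, C_add, C_mul]
  ring

lemma tri_swap (x y z : ℤ) : tri x y z = tri y x z := by
  simp only [tri]; ring

lemma tri_swap_right (x y z : ℤ) : tri x y z = tri x z y := by
  simp only [tri]; ring

lemma cub_eq (a b c : ℤ) :
    cub a b c = X ^ 3 + C (b - a) * X ^ 2 + C (c - a * b) * X + C (-(a * c)) := by
  simp only [cub, C_neg, C_sub, C_mul]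
  ring

lemma coeff_zero_cub (a b c : ℤ) : (cub a b c).coeff 0 = -(a * c) := by
  rw [cub_eq]; simp

lemma coeff_one_cub (a b c : ℤ) : (cub a b c).coeff 1 = c - a * b := by
  rw [cub_eq]; simp [coeff_X_pow, coeff_C, -eq_intCast, -map_sub, -map_mul, -map_neg, -map_add]

lemma coeff_two_cub (a b c : ℤ) : (cub a b c).coeff 2 = b - a := by
  rw [cub_eq]; simp [coeff_X_pow, -eq_intCast, -map_sub, -map_mul, -map_neg, -map_add]

lemma exists_eq_cub {f : ℤ[X]} (hf : f.Monic) (hd : f.natDegree = 3) {a : ℤ}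
    (ha : f.eval a = 0) : ∃ b c, f = cub a b c := by
  obtain ⟨q, hq⟩ := dvd_iff_isRoot.2 ha
  have hqm : q.Monic := (monic_X_sub_C a).of_mul_monic_left (hq ▸ hf)
  have hqd : q.natDegree = 2 := by
    have := congrArg natDegree hq
    rw [(monic_X_sub_C a).natDegree_mul hqm, natDegree_X_sub_C, hd] at this
    omega
  refine ⟨q.coeff 1, q.coeff 0, ?_⟩
  have h2 : q.coeff 2 = 1 := by rw [← hqd]; exact hqm
  have : q = X ^ 2 + C (q.coeff 1) * X + C (q.coeff 0) := by
    conv_lhs => rw [q.as_sum_range_C_mul_X_pow, hqd]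
    simp [Finset.sum_range_succ, h2]
    ring
  rw [hq, cub]
  congr 1

lemma exists_root_of_not_irreducible {f : ℤ[X]} (hf : f.Monic) (hd : f.natDegree = 3)
    (hi : ¬ Irreducible f) : ∃ a : ℤ, f.eval a = 0 := by
  rw [hf.irreducible_iff_roots_eq_zero_of_degree_le_three (by omega) (by omega)] at hi
  obtain ⟨a, ha⟩ := Multiset.exists_mem_of_ne_zero hi
  exact ⟨a, (mem_roots hf.ne_zero).1 ha⟩

lemma mem_nzRoots {f : ℤ[X]} (hf : f.Monic) (z : ℂ) :
    z ∈ nzRoots f ↔ (f.map (Int.castRingHom ℂ)).eval z = 0 ∧ z ≠ 0 := by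
  simp [nzRoots, (hf.map (Int.castRingHom ℂ)).ne_zero]

lemma genDeg_of_eval_eq_zero {f : ℤ[X]} (hf : f.Monic) (hd : f.natDegree = 3) {e : ℤ}
    (he : e = 1 ∨ e = -1) (h : f.eval e = 0) : GenDeg f := by
  classical
  have hmem : (e : ℂ) ∈ nzRoots f := by
    rw [mem_nzRoots hf]
    refine ⟨?_, by rcases he with rfl | rfl <;> simp⟩
    have := congrArg (Int.castRingHom ℂ) h
    simpa [eval_map, hom_eval₂, eval₂_at_intCast] using this
  refine ⟨by omega, Pi.single (e : ℂ) 2, ⟨_, hmem, by simp⟩, ?_⟩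
  rw [Finset.prod_eq_single_of_mem _ hmem]
  · rcases he with rfl | rfl <;> simp
  · intro z _ hz
    simp [Pi.single_eq_of_ne hz]

lemma mulDep_pair {u v : ℂ} (huv : u ≠ v) (h : MulDep {u, v}) :
    ∃ l m : ℤ, ¬ (l = 0 ∧ m = 0) ∧ u ^ l * v ^ m = 1 := by
  obtain ⟨k, ⟨z, hz, hk⟩, hp⟩ := h
  rw [Finset.prod_pair huv] at hp
  refine ⟨k u, k v, ?_, hp⟩
  rintro ⟨h1, h2⟩
  simp only [Finset.mem_insert, Finset.mem_singleton] at hz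
  rcases hz with rfl | rfl <;> contradiction

lemma mulDep_triple {u v w : ℂ} (huv : u ≠ v) (huw : u ≠ w) (hvw : v ≠ w)
    (h : MulDep {u, v, w}) :
    ∃ l m n : ℤ, ¬ (l = 0 ∧ m = 0 ∧ n = 0) ∧ u ^ l * v ^ m * w ^ n = 1 := by
  obtain ⟨k, ⟨z, hz, hk⟩, hp⟩ := h
  rw [Finset.prod_insert (by simp [huv, huw]), Finset.prod_pair hvw, ← mul_assoc] at hp
  refine ⟨k u, k v, k w, ?_, hp⟩
  rintro ⟨h1, h2, h3⟩
  simp only [Finset.mem_insert, Finset.mem_singleton] at hz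
  rcases hz with rfl | rfl | rfl <;> contradiction

lemma exists_quadratic_roots (b c : ℤ) :
    ∃ α β : ℂ, α + β = -b ∧ α * β = c := by
  obtain ⟨s, hs⟩ := IsAlgClosed.exists_pow_nat_eq ((b : ℂ) ^ 2 - 4 * c) (n := 2) (by norm_num)
  refine ⟨(-b + s) / 2, (-b - s) / 2, by ring, ?_⟩
  linear_combination -hs / 4

lemma eval_map_cub {α β : ℂ} {a b c : ℤ} (h1 : α + β = -b) (h2 : α * β = c) (z : ℂ) :
    ((cub a b c).map (Int.castRingHom ℂ)).eval z = (z - a) * ((z - α) * (z - β)) := by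
  simp only [cub, Polynomial.map_mul, Polynomial.map_sub, map_X, map_C, Polynomial.map_add,
    Polynomial.map_pow, eval_mul, eval_sub, eval_X, eval_C, eval_add, eval_pow,
    Int.coe_castRingHom]
  rw [← h2, show (b : ℂ) = -(α + β) by rw [h1]; ring]
  ring

lemma exists_pow_eq_linear (b c : ℤ) (N : ℕ) :
    ∃ u v : ℤ, ∀ z : ℂ, z ^ 2 + b * z + c = 0 → z ^ N = u + v * z := by
  induction N with
  | zero => exact ⟨1, 0, fun z _ => by simp⟩
  | succ N ih =>
    obtain ⟨u, v, h⟩ := ih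
    refine ⟨-(v * c), u - v * b, fun z hz => ?_⟩
    rw [pow_succ, h z hz]
    push_cast
    linear_combination (v : ℂ) * hz

lemma sq_eq_mul_of_ratio_pow_eq_one {α β : ℂ} {b c : ℤ} (h1 : α + β = -b) (h2 : α * β = c)
    (hc : c ≠ 0) {N : ℕ} (hN : N ≠ 0) (h : α ^ N = β ^ N) :
    ∃ t : ℕ, t < 5 ∧ b ^ 2 = t * c := by
  have hc' : (c : ℂ) ≠ 0 := by exact_mod_cast hc
  have hα : α ≠ 0 := by rintro rfl; simp at h2; exact hc' h2.symm
  have hβ : β ≠ 0 := by rintro rfl; simp at h2; exact hc' h2.symm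
  set ζ := α / β with hζ
  have hζN : ζ ^ N = 1 := by rw [hζ, div_pow, h, div_self (pow_ne_zero _ hβ)]
  have hζN' : (ζ⁻¹) ^ N = 1 := by rw [inv_pow, hζN, inv_one]
  have i1 : IsIntegral ℤ ζ := IsIntegral.of_pow (Nat.pos_of_ne_zero hN) (hζN ▸ isIntegral_one)
  have i2 : IsIntegral ℤ ζ⁻¹ :=
    IsIntegral.of_pow (Nat.pos_of_ne_zero hN) (hζN' ▸ isIntegral_one)
  have hs : ζ + ζ⁻¹ = (((b ^ 2 - 2 * c : ℤ) / (c : ℤ) : ℚ) : ℂ) := by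
    push_cast
    rw [hζ, inv_div, ← h2, show (b : ℂ) = -(α + β) by rw [h1]; ring]
    field_simp
    ring
  have hi : IsIntegral ℤ ((b ^ 2 - 2 * c : ℤ) / (c : ℤ) : ℚ) := by
    have := i1.add i2
    rw [hs] at this
    exact (isIntegral_algebraMap_iff (A := ℚ) (B := ℂ) (Rat.cast_injective)).1 this
  obtain ⟨T, hT⟩ := IsIntegrallyClosed.isIntegral_iff.1 hi
  rw [← hT] at hs
  have hTb : |T| ≤ 2 := by
    have n1 : ‖ζ‖ = 1 := Complex.norm_eq_one_of_pow_eq_one hζN hN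
    have n2 : ‖ζ⁻¹‖ = 1 := Complex.norm_eq_one_of_pow_eq_one hζN' hN
    have := norm_add_le ζ ζ⁻¹
    rw [hs, n1, n2] at this
    simp only [algebraMap_int_eq, eq_intCast, Rat.cast_intCast, Complex.norm_intCast] at this
    have h3 : ((|T| : ℤ) : ℝ) ≤ (2 : ℤ) := by push_cast; linarith
    exact_mod_cast h3
  have hcq : (c : ℚ) ≠ 0 := by exact_mod_cast hc
  have e : (b : ℚ) ^ 2 - 2 * c = T * c := by
    have : (T : ℚ) = ((b ^ 2 - 2 * c : ℤ) / (c : ℤ) : ℚ) := by simpa using hT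
    rw [this]; push_cast; field_simp
  have e' : b ^ 2 - 2 * c = T * c := by exact_mod_cast e
  rw [abs_le] at hTb
  refine ⟨(T + 2).toNat, by omega, ?_⟩
  rw [Int.toNat_of_nonneg (by omega)]
  linarith

lemma quadratic_dependence {α β : ℂ} {b c e : ℤ} (h1 : α + β = -b) (h2 : α * β = c)
    (hc : c ≠ 0) (he : e ≠ 0) (hα : ∀ r : ℚ, α ≠ r) {m n k : ℤ}
    (h : α ^ m * β ^ n * (e : ℂ) ^ k = 1) :
    (∃ t : ℕ, t < 5 ∧ b ^ 2 = t * c) ∨ (m = n ∧ (c : ℂ) ^ n * (e : ℂ) ^ k = 1) := by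
  have hc' : (c : ℂ) ≠ 0 := by exact_mod_cast hc
  have he' : (e : ℂ) ≠ 0 := by exact_mod_cast he
  have hα0 : α ≠ 0 := by rintro rfl; simp at h2; exact hc' h2.symm
  have hβ0 : β ≠ 0 := by rintro rfl; simp at h2; exact hc' h2.symm
  have h3 : α ^ (m - n) * (c : ℂ) ^ n * (e : ℂ) ^ k = 1 := by
    rw [← h, ← h2, mul_zpow, ← mul_assoc (α ^ (m - n)), ← zpow_add₀ hα0]
    simp
  rcases eq_or_ne m n with hmn | hmn
  · right
    subst hmn
    simpa using h3
  left
  have hrat : ∃ (M : ℕ) (r : ℚ), M ≠ 0 ∧ α ^ M = r := by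
    have e1 : α ^ (m - n) = (((c : ℚ) ^ n * (e : ℚ) ^ k)⁻¹ : ℚ) := by
      push_cast
      exact eq_inv_of_mul_eq_one_left (by rw [← mul_assoc, h3])
    obtain ⟨M, hM | hM⟩ := Int.eq_nat_or_neg (m - n)
    · exact ⟨M, _, by omega, by rw [← e1, hM, zpow_natCast]⟩
    · refine ⟨M, (((c : ℚ) ^ n * (e : ℚ) ^ k)⁻¹)⁻¹, by omega, ?_⟩
      rw [Rat.cast_inv, ← e1, hM, zpow_neg, inv_inv, zpow_natCast]
  obtain ⟨M, r, hM, hr⟩ := hrat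
  obtain ⟨u, v, huv⟩ := exists_pow_eq_linear b c M
  have hb : (b : ℂ) = -(α + β) := by rw [h1]; ring
  have eα := huv α (by rw [hb, ← h2]; ring)
  have eβ := huv β (by rw [hb, ← h2]; ring)
  have hv : v = 0 := by
    by_contra hv
    have hv' : (v : ℂ) ≠ 0 := by exact_mod_cast hv
    apply hα ((r - u) / v)
    push_cast
    rw [eq_div_iff hv', ← hr, eα]
    ring
  subst hv
  exact sq_eq_mul_of_ratio_pow_eq_one h1 h2 hc hM (by rw [eα, eβ]; simp)

lemma ne_ratCast_of_no_int_root {α β : ℂ} {b c : ℤ} (h1 : α + β = -b) (h2 : α * β = c)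
    (h : ∀ x : ℤ, x ^ 2 + b * x + c ≠ 0) (r : ℚ) : α ≠ r := by
  rintro rfl
  have hb : (b : ℂ) = -(r + β) := by rw [h1]; ring
  have e : (r : ℂ) ^ 2 + b * r + c = 0 := by rw [hb, ← h2]; ring
  have e' : r ^ 2 + b * r + c = 0 := by exact_mod_cast e
  have hi : IsIntegral ℤ r := by
    refine ⟨X ^ 2 + C b * X + C c, by monicity!, ?_⟩
    simpa only [eval₂_add, eval₂_mul, eval₂_X_pow, eval₂_X, eval₂_C, algebraMap_int_eq,
      Int.coe_castRingHom] using e'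
  obtain ⟨x, rfl⟩ := IsIntegrallyClosed.isIntegral_iff.1 hi
  simp only [algebraMap_int_eq, eq_intCast] at e'
  exact h x (by exact_mod_cast e')

/-- Cubics `X (X² + b X + c)` with `c ∈ {0, 1, -1}`. -/
def zeroRootSmall (N : ℕ) : Set ℤ[X] :=
  {f | ∃ b c : ℤ, |b| ≤ N ∧ (c = 0 ∨ c = 1 ∨ c = -1) ∧ f = cub 0 b c}

/-- Cubics `X (X² + b X + c)` with `b² = t c`, `0 ≤ t ≤ 4`. -/
def zeroRootRatio (N : ℕ) : Set ℤ[X] :=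
  {f | ∃ (b c : ℤ) (t : ℕ), t < 5 ∧ |c| ≤ N ∧ b ^ 2 = t * c ∧ f = cub 0 b c}

/-- Cubics `X (X - r) (X - s)` with `r s ≠ 0`. -/
def zeroRootSplit (N : ℕ) : Set ℤ[X] :=
  {f | ∃ r s : ℤ, r * s ≠ 0 ∧ |r * s| ≤ N ∧ f = tri 0 r s}

/-- Cubics `(X - a) (X² + b X + c)` with `a c ≠ 0` and `b² = t c`, `0 ≤ t ≤ 4`. -/
def rootRatio (N : ℕ) : Set ℤ[X] :=
  {f | ∃ (a b c : ℤ) (t : ℕ), t < 5 ∧ a * c ≠ 0 ∧ |a * c| ≤ N ∧ b ^ 2 = t * c ∧ f = cub a b c}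

/-- Cubics `(X - a) (X² + b X + c)` where `|a|` and `|c|` are powers of a common integer. -/
def rootPower (N : ℕ) : Set ℤ[X] :=
  {f | ∃ (a b c : ℤ) (g i j : ℕ), 2 ≤ g ∧ 1 ≤ i ∧ a.natAbs = g ^ i ∧ c.natAbs = g ^ j ∧
    |a * c| ≤ N ∧ |b - a| ≤ N ∧ |c - a * b| ≤ N ∧ f = cub a b c}

/-- Cubics with three integer roots, two of which are powers of a common integer up to sign. -/
def splitPower (N : ℕ) : Set ℤ[X] :=
  {f | ∃ (x y z : ℤ) (g i j : ℕ), 2 ≤ g ∧ 1 ≤ i ∧ 1 ≤ j ∧ x.natAbs = g ^ i ∧ y.natAbs = g ^ j ∧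
    z ≠ 0 ∧ |x * y * z| ≤ N ∧ f = tri x y z}

/-- Cubics with three dependent integer roots, the two smaller ones being independent. -/
def splitIndep (N : ℕ) : Set ℤ[X] :=
  {f | ∃ x y z : ℤ, x * y ≠ 0 ∧ |x * y| ≤ N ∧ (x * y).natAbs ^ 3 ≤ N ^ 2 ∧
    ValIndep x.natAbs y.natAbs ∧ z ∈ depSet N x.natAbs y.natAbs ∧ f = tri x y z}

/-- The union of the exceptional families. -/
def exceptional (N : ℕ) : Set ℤ[X] :=
  zeroRootSmall N ∪ zeroRootRatio N ∪ zeroRootSplit N ∪ rootRatio N ∪ rootPower N ∪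
    splitPower N ∪ splitIndep N

lemma tri_zero_mem_exceptional {N : ℕ} {y z : ℤ} (hH : HeightLe (tri 0 y z) N) :
    tri 0 y z ∈ exceptional N := by
  have h1 := hH 1
  have h2 := hH 2
  rw [tri_eq_cub, coeff_one_cub] at h1
  rw [tri_eq_cub, coeff_two_cub] at h2
  simp only [exceptional, Set.mem_union]
  rcases eq_or_ne (y * z) 0 with h0 | h0
  · exact Or.inl <| Or.inl <| Or.inl <| Or.inl <| Or.inl <| Or.inl
      ⟨-(y + z), y * z, by simpa using h2, Or.inl h0, tri_eq_cub _ _ _⟩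
  · exact Or.inl <| Or.inl <| Or.inl <| Or.inl <| Or.inr ⟨y, z, h0, by simpa using h1, rfl⟩

lemma tri_mem_exceptional_of_not_valIndep {N : ℕ} {x y z : ℤ} (hH : HeightLe (tri x y z) N)
    (hx : 2 ≤ x.natAbs) (hy : 2 ≤ y.natAbs) (hz : z ≠ 0)
    (h : ¬ ValIndep x.natAbs y.natAbs) : tri x y z ∈ exceptional N := by
  simp only [ValIndep, not_forall] at h
  obtain ⟨l, m, hr, hlm⟩ := h
  obtain ⟨g, i, j, hg, hi, hxg, hyg⟩ := exists_eq_pow_of_valRel hx (by omega) hlm hr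
  have hj : 1 ≤ j := by
    by_contra hj
    obtain rfl : j = 0 := by omega
    simp at hyg; omega
  have h0 := hH 0
  rw [tri_eq_cub, coeff_zero_cub, abs_neg, ← mul_assoc] at h0
  exact Or.inl <| Or.inr ⟨x, y, z, g, i, j, hg, hi, hj, hxg, hyg, hz, h0, rfl⟩

lemma tri_mem_exceptional_of_valIndep {N : ℕ} {x y z : ℤ} (hH : HeightLe (tri x y z) N)
    (hx : x ≠ 0) (hy : y ≠ 0) (hz : z ≠ 0) (h : ValIndep x.natAbs y.natAbs)
    (hxz : x.natAbs ≤ z.natAbs) (hyz : y.natAbs ≤ z.natAbs) {l m n : ℤ}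
    (hlmn : ¬ (l = 0 ∧ m = 0 ∧ n = 0))
    (hr : ValRel x.natAbs y.natAbs z.natAbs l m n) : tri x y z ∈ exceptional N := by
  have h0 := hH 0
  rw [tri_eq_cub, coeff_zero_cub, abs_neg, ← mul_assoc, Int.abs_eq_natAbs, Nat.cast_le,
    Int.natAbs_mul] at h0
  have hxy : 0 < (x * y).natAbs := Int.natAbs_pos.2 (mul_ne_zero hx hy)
  have hz0 : 0 < z.natAbs := Int.natAbs_pos.2 hz
  have hn : n ≠ 0 := by
    rintro rfl
    have := h l m (fun p => by have := hr p; simpa using this)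
    exact hlmn ⟨this.1, this.2, rfl⟩
  have hxyz : (x * y).natAbs ≤ z.natAbs ^ 2 := by
    rw [Int.natAbs_mul, sq]; exact Nat.mul_le_mul hxz hyz
  refine Or.inr ⟨x, y, z, mul_ne_zero hx hy, ?_, ?_, h, ?_, rfl⟩
  · rw [Int.abs_eq_natAbs, Nat.cast_le]
    exact (Nat.le_mul_of_pos_right _ hz0).trans h0
  · calc (x * y).natAbs ^ 3 = (x * y).natAbs ^ 2 * (x * y).natAbs := pow_succ _ _
      _ ≤ (x * y).natAbs ^ 2 * z.natAbs ^ 2 := Nat.mul_le_mul_left _ hxyz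
      _ = ((x * y).natAbs * z.natAbs) ^ 2 := by ring
      _ ≤ N ^ 2 := Nat.pow_le_pow_left h0 2
  · have : z.natAbs ≤ N := (Nat.le_mul_of_pos_left _ hxy).trans h0
    rw [mem_depSet]
    exact ⟨by omega, hz, l, m, n, hn, hr⟩

lemma monic_cub (a b c : ℤ) : (cub a b c).Monic := by
  rw [cub_eq]; monicity!

lemma monic_tri (x y z : ℤ) : (tri x y z).Monic := tri_eq_cub x y z ▸ monic_cub _ _ _

lemma nzRoots_tri {x y z : ℤ} (hx : x ≠ 0) (hy : y ≠ 0) (hz : z ≠ 0) :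
    nzRoots (tri x y z) = {(x : ℂ), (y : ℂ), (z : ℂ)} := by
  ext w
  rw [mem_nzRoots (monic_tri x y z)]
  simp only [tri, Polynomial.map_mul, Polynomial.map_sub, map_X, map_C, eval_mul, eval_sub,
    eval_X, eval_C, Int.coe_castRingHom, mul_eq_zero, sub_eq_zero, Finset.mem_insert,
    Finset.mem_singleton, or_assoc]
  constructor
  · exact fun h => h.1
  · rintro (rfl | rfl | rfl) <;> simp [*]

lemma not_valIndep_self {x y : ℤ} (h : x = y) : ¬ ValIndep x.natAbs y.natAbs := by
  subst h
  intro h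
  have := (h 1 (-1) (fun p => by ring)).1
  norm_num at this

lemma two_le_natAbs_of_eval_tri_ne_zero {x y z : ℤ} (h1 : (tri x y z).eval 1 ≠ 0)
    (h2 : (tri x y z).eval (-1) ≠ 0) (hx : x ≠ 0) : 2 ≤ x.natAbs := by
  by_contra hlt
  have : x = 1 ∨ x = -1 := by omega
  rcases this with rfl | rfl
  · simp [tri] at h1
  · simp [tri] at h2

lemma tri_mem_exceptional {N : ℕ} {x y z : ℤ} (hH : HeightLe (tri x y z) N)
    (hG : GenDeg (tri x y z)) (h1 : (tri x y z).eval 1 ≠ 0)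
    (h2 : (tri x y z).eval (-1) ≠ 0) : tri x y z ∈ exceptional N := by
  have e1 : tri x y z = tri y x z := tri_swap x y z
  have e2 : tri x y z = tri x z y := tri_swap_right x y z
  have e3 : tri x y z = tri z x y := by rw [e2, tri_swap]
  have e4 : tri x y z = tri y z x := by rw [e1, tri_swap_right]
  by_cases hx : x = 0
  · subst hx; exact tri_zero_mem_exceptional hH
  by_cases hy : y = 0
  · subst hy; rw [e1] at hH ⊢; exact tri_zero_mem_exceptional hH
  by_cases hz : z = 0
  · subst hz; rw [e3] at hH ⊢; exact tri_zero_mem_exceptional hH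
  have hx2 := two_le_natAbs_of_eval_tri_ne_zero h1 h2 hx
  have hy2 := two_le_natAbs_of_eval_tri_ne_zero (e1 ▸ h1) (e1 ▸ h2) hy
  have hz2 := two_le_natAbs_of_eval_tri_ne_zero (e3 ▸ h1) (e3 ▸ h2) hz
  by_cases ixy : ValIndep x.natAbs y.natAbs
  swap
  · exact tri_mem_exceptional_of_not_valIndep hH hx2 hy2 hz ixy
  by_cases ixz : ValIndep x.natAbs z.natAbs
  swap
  · rw [e2] at hH ⊢; exact tri_mem_exceptional_of_not_valIndep hH hx2 hz2 hy ixz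
  by_cases iyz : ValIndep y.natAbs z.natAbs
  swap
  · rw [e4] at hH ⊢; exact tri_mem_exceptional_of_not_valIndep hH hy2 hz2 hx iyz
  have nxy : (x : ℂ) ≠ y := fun h => not_valIndep_self (by exact_mod_cast h) ixy
  have nxz : (x : ℂ) ≠ z := fun h => not_valIndep_self (by exact_mod_cast h) ixz
  have nyz : (y : ℂ) ≠ z := fun h => not_valIndep_self (by exact_mod_cast h) iyz
  have hM := hG.2
  rw [nzRoots_tri hx hy hz] at hM
  obtain ⟨l, m, n, hlmn, hp⟩ := mulDep_triple nxy nxz nyz hM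
  have hr := valRel_of_zpow_mul_eq_one hx hy hz hp
  by_cases hzmax : x.natAbs ≤ z.natAbs ∧ y.natAbs ≤ z.natAbs
  · exact tri_mem_exceptional_of_valIndep hH hx hy hz ixy hzmax.1 hzmax.2 hlmn hr
  by_cases hymax : x.natAbs ≤ y.natAbs ∧ z.natAbs ≤ y.natAbs
  · rw [e2] at hH ⊢
    exact tri_mem_exceptional_of_valIndep (l := l) (m := n) (n := m) hH hx hz hy ixz
      hymax.1 hymax.2 (by tauto) (fun p => by linarith [hr p])
  · rw [e4] at hH ⊢
    exact tri_mem_exceptional_of_valIndep (l := m) (m := n) (n := l) hH hy hz hx iyz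
      (by omega) (by omega) (by tauto) (fun p => by linarith [hr p])

lemma cub_mem_exceptional {N : ℕ} {a b c : ℤ} (hH : HeightLe (cub a b c) N)
    (hG : GenDeg (cub a b c)) (h1 : (cub a b c).eval 1 ≠ 0) (h2 : (cub a b c).eval (-1) ≠ 0)
    (hirr : ∀ x : ℤ, x ^ 2 + b * x + c ≠ 0) : cub a b c ∈ exceptional N := by
  have k0 := hH 0
  have k1 := hH 1
  have k2 := hH 2
  rw [coeff_zero_cub, abs_neg] at k0
  rw [coeff_one_cub] at k1
  rw [coeff_two_cub] at k2
  have hc : c ≠ 0 := by simpa using hirr 0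
  have hc' : (c : ℂ) ≠ 0 := by exact_mod_cast hc
  obtain ⟨α, β, hs, hp⟩ := exists_quadratic_roots b c
  have hα := ne_ratCast_of_no_int_root hs hp hirr
  have hβ := ne_ratCast_of_no_int_root (add_comm α β ▸ hs) (mul_comm α β ▸ hp) hirr
  have hα0 : α ≠ 0 := by simpa using hα 0
  have hβ0 : β ≠ 0 := by simpa using hβ 0
  have hαβ : α ≠ β := by
    rintro rfl
    apply hα (-b / 2)
    push_cast
    rw [← hs]; ring
  have hmem := mem_nzRoots (monic_cub a b c)
  simp only [eval_map_cub hs hp] at hmem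
  by_cases ha : a = 0
  · subst ha
    have hnz : nzRoots (cub 0 b c) = {α, β} := by
      ext z
      rw [hmem]
      simp only [Int.cast_zero, sub_zero, mul_eq_zero, sub_eq_zero, Finset.mem_insert,
        Finset.mem_singleton]
      constructor
      · rintro ⟨h | h, h'⟩
        · exact absurd h h'
        · exact h
      · rintro (rfl | rfl) <;> simp [*]
    have hM := hG.2
    rw [hnz] at hM
    obtain ⟨m, n, hmn, hrel⟩ := mulDep_pair hαβ hM
    rcases quadratic_dependence (e := 1) (k := 0) hs hp hc one_ne_zero hα (by simpa using hrel)
      with ⟨t, ht, hbt⟩ | ⟨rfl, hcn⟩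
    · exact Or.inl <| Or.inl <| Or.inl <| Or.inl <| Or.inl <| Or.inr
        ⟨b, c, t, ht, by simpa using k1, hbt, rfl⟩
    · have hm : m ≠ 0 := fun h => hmn ⟨h, h⟩
      have hval := valRel_of_zpow_mul_eq_one (l := m) (m := 0) (n := 0) hc one_ne_zero one_ne_zero
        (by simpa using hcn)
      have hc1 : c.natAbs = 1 := by
        by_contra hne
        have h2c : 2 ≤ c.natAbs := by omega
        have hq := Nat.minFac_prime (by omega : c.natAbs ≠ 1)
        have hpos := hq.factorization_pos_of_dvd (by omega) (Nat.minFac_dvd c.natAbs)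
        have := hval c.natAbs.minFac
        simp [hm] at this
        omega
      exact Or.inl <| Or.inl <| Or.inl <| Or.inl <| Or.inl <| Or.inl
        ⟨b, c, by simpa using k2, by omega, rfl⟩
  · have ha2 : 2 ≤ a.natAbs := by
      by_contra hlt
      have : a = 1 ∨ a = -1 := by omega
      rcases this with rfl | rfl
      · simp [cub] at h1
      · simp [cub] at h2
    have haC : (a : ℂ) ≠ 0 := by exact_mod_cast ha
    have hnz : nzRoots (cub a b c) = {α, β, (a : ℂ)} := by
      ext z
      rw [hmem]
      simp only [mul_eq_zero, sub_eq_zero, Finset.mem_insert, Finset.mem_singleton]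
      constructor
      · tauto
      · rintro (rfl | rfl | rfl) <;> simp [*]
    have hM := hG.2
    rw [hnz] at hM
    obtain ⟨m, n, k, hmnk, hrel⟩ := mulDep_triple hαβ (by simpa using hα a)
      (by simpa using hβ a) hM
    rcases quadratic_dependence hs hp hc ha hα hrel with ⟨t, ht, hbt⟩ | ⟨rfl, hcn⟩
    · exact Or.inl <| Or.inl <| Or.inl <| Or.inr
        ⟨a, b, c, t, ht, mul_ne_zero ha hc, k0, hbt, rfl⟩
    · have hval := valRel_of_zpow_mul_eq_one (l := k) (m := m) (n := 0) ha hc one_ne_zero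
        (by simpa [mul_comm] using hcn)
      obtain ⟨g, i, j, hg, hi, hag, hcg⟩ := exists_eq_pow_of_valRel ha2 (by omega)
        (by tauto) hval
      exact Or.inl <| Or.inl <| Or.inr ⟨a, b, c, g, i, j, hg, hi, hag, hcg, k0, k2, k1, rfl⟩

/-- A reducible generalized degenerate monic cubic without root `±1` is exceptional. -/
lemma mem_exceptional_of_mem_Rset {N : ℕ} {f : ℤ[X]} (hf : f ∈ Rset 3 N) (h1 : f.eval 1 ≠ 0)
    (h2 : f.eval (-1) ≠ 0) : f ∈ exceptional N := by
  obtain ⟨hm, hd, hH, hi, hG⟩ := hf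
  obtain ⟨a, ha⟩ := exists_root_of_not_irreducible hm hd hi
  obtain ⟨b, c, rfl⟩ := exists_eq_cub hm hd ha
  by_cases hirr : ∀ x : ℤ, x ^ 2 + b * x + c ≠ 0
  · exact cub_mem_exceptional hH hG h1 h2 hirr
  · push Not at hirr
    obtain ⟨x, hx⟩ := hirr
    have e : cub a b c = tri a x (-b - x) := by
      rw [tri_eq_cub]
      congr 1
      · ring
      · linarith
    rw [e] at hH hG h1 h2 ⊢
    exact tri_mem_exceptional hH hG h1 h2

lemma ncard_le_sum_of_cover {ι β : Type*} {E : Set β} (I : Finset ι)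
    (F : ι → Finset β) (w : ι → ℝ) (h : ∀ e ∈ E, ∃ i ∈ I, e ∈ F i)
    (hw : ∀ i ∈ I, ((F i).card : ℝ) ≤ w i) : (E.ncard : ℝ) ≤ ∑ i ∈ I, w i := by
  classical
  have hsub : E ⊆ ((I.biUnion F : Finset β) : Set β) := by
    intro e he
    simpa using h e he
  have h1 := Set.ncard_le_ncard hsub (Finset.finite_toSet _)
  rw [Set.ncard_coe_finset] at h1
  calc (E.ncard : ℝ) ≤ ((I.biUnion F).card : ℝ) := by exact_mod_cast h1
    _ ≤ ((∑ i ∈ I, (F i).card : ℕ) : ℝ) := by exact_mod_cast Finset.card_biUnion_le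
    _ ≤ ∑ i ∈ I, w i := by push_cast; exact Finset.sum_le_sum hw

lemma ncard_le_card_of_image {ι β : Type*} {E : Set β} (I : Finset ι)
    (F : ι → β) (h : ∀ e ∈ E, ∃ i ∈ I, e = F i) : E.ncard ≤ I.card := by
  classical
  have hsub : E ⊆ ((I.image F : Finset β) : Set β) := by
    intro e he
    obtain ⟨i, hi, rfl⟩ := h e he
    exact Finset.mem_coe.2 (Finset.mem_image_of_mem F hi)
  have h1 := Set.ncard_le_ncard hsub (Finset.finite_toSet _)
  rw [Set.ncard_coe_finset] at h1
  exact h1.trans Finset.card_image_le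

/-- The two signs. -/
def signs : Finset ℤ := {1, -1}

lemma card_signs : signs.card = 2 := rfl

lemma exists_sign_mul_natAbs (a : ℤ) : ∃ s ∈ signs, a = s * a.natAbs := by
  rcases Int.natAbs_eq a with h | h
  · exact ⟨1, by simp [signs], by omega⟩
  · exact ⟨-1, by simp [signs], by omega⟩

/-- Pairs of integers with nonzero product of absolute value at most `N`. -/
noncomputable def prodPairs (N : ℕ) : Finset (ℤ × ℤ) :=
  (Finset.Icc (-(N : ℤ)) N ×ˢ Finset.Icc (-(N : ℤ)) N).filter
    (fun p => p.1 * p.2 ≠ 0 ∧ |p.1 * p.2| ≤ N)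

lemma mem_prodPairs {N : ℕ} {x y : ℤ} :
    (x, y) ∈ prodPairs N ↔ x * y ≠ 0 ∧ |x * y| ≤ N := by
  rw [prodPairs, Finset.mem_filter, Finset.mem_product, Finset.mem_Icc, Finset.mem_Icc]
  refine ⟨fun h => h.2, fun h => ⟨?_, h⟩⟩
  have hx : 0 < x.natAbs := Int.natAbs_pos.2 (left_ne_zero_of_mul h.1)
  have hy : 0 < y.natAbs := Int.natAbs_pos.2 (right_ne_zero_of_mul h.1)
  have h2 := h.2
  rw [Int.abs_eq_natAbs, Nat.cast_le, Int.natAbs_mul] at h2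
  have h3 := (Nat.le_mul_of_pos_right x.natAbs hy).trans h2
  have h4 := (Nat.le_mul_of_pos_left y.natAbs hx).trans h2
  dsimp only
  omega

lemma card_prodPairs_le (N : ℕ) :
    ((prodPairs N).card : ℝ) ≤ 4 * (N * (1 + Real.log N)) := by
  have h := ncard_le_sum_of_cover (E := (prodPairs N : Set (ℤ × ℤ)))
    (Finset.Icc 1 N)
    (fun n : ℕ => (signs ×ˢ signs ×ˢ Finset.Icc 1 (N / n)).image
      (fun q : ℤ × ℤ × ℕ => (q.1 * (n : ℤ), q.2.1 * (q.2.2 : ℤ))))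
    (fun n => 4 * (N * (n : ℝ)⁻¹)) ?_ ?_
  · rw [Set.ncard_coe_finset, ← Finset.mul_sum, ← Finset.mul_sum] at h
    refine h.trans ?_
    have := harmonic_le_one_add_log N
    rw [harmonic_eq_sum_Icc] at this
    push_cast at this
    gcongr
  · rintro ⟨x, y⟩ hxy
    rw [Finset.mem_coe, mem_prodPairs] at hxy
    obtain ⟨h0, h1⟩ := hxy
    have hx : 0 < x.natAbs := Int.natAbs_pos.2 (left_ne_zero_of_mul h0)
    have hy : 0 < y.natAbs := Int.natAbs_pos.2 (right_ne_zero_of_mul h0)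
    rw [Int.abs_eq_natAbs, Nat.cast_le, Int.natAbs_mul] at h1
    obtain ⟨s, hs, hxs⟩ := exists_sign_mul_natAbs x
    obtain ⟨t, ht, hyt⟩ := exists_sign_mul_natAbs y
    refine ⟨x.natAbs, Finset.mem_Icc.2 ⟨hx, (Nat.le_mul_of_pos_right _ hy).trans h1⟩, ?_⟩
    refine Finset.mem_image.2 ⟨(s, t, y.natAbs), ?_, by rw [← hxs, ← hyt]⟩
    simp only [Finset.mem_product, Finset.mem_Icc]
    exact ⟨hs, ht, hy, (Nat.le_div_iff_mul_le hx).2 (by rwa [mul_comm])⟩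
  · intro n _
    have h1 : _ ≤ _ := Finset.card_image_le (s := signs ×ˢ signs ×ˢ Finset.Icc 1 (N / n))
      (f := (fun q : ℤ × ℤ × ℕ => (q.1 * (n : ℤ), q.2.1 * (q.2.2 : ℤ))))
    rw [Finset.card_product, Finset.card_product, card_signs, Nat.card_Icc,
      Nat.add_sub_cancel] at h1
    calc _ ≤ ((2 * (2 * (N / n)) : ℕ) : ℝ) := by exact_mod_cast h1
      _ = 4 * ((N / n : ℕ) : ℝ) := by push_cast; ring
      _ ≤ 4 * (N * (n : ℝ)⁻¹) := by
        gcongr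
        rw [← div_eq_mul_inv]
        exact Nat.cast_div_le

lemma eq_sign_mul_sqrt {b d : ℤ} (h : b ^ 2 = d) : ∃ s ∈ signs, b = s * Nat.sqrt d.natAbs := by
  obtain ⟨s, hs, hb⟩ := exists_sign_mul_natAbs b
  refine ⟨s, hs, ?_⟩
  rw [← h, Int.natAbs_pow, Nat.sqrt_eq', ← hb]

lemma card_Icc_neg (N : ℕ) : (Finset.Icc (-(N : ℤ)) N).card = 2 * N + 1 := by
  rw [Int.card_Icc]; omega

lemma ncard_le_of_subset_zeroRootSmall {N : ℕ} {R : Set ℤ[X]} (hR : R ⊆ zeroRootSmall N) :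
    R.ncard ≤ (2 * N + 1) * 3 := by
  refine (ncard_le_card_of_image (Finset.Icc (-(N : ℤ)) N ×ˢ ({0, 1, -1} : Finset ℤ))
    (fun p => cub 0 p.1 p.2) ?_).trans (le_of_eq ?_)
  · intro f hf
    obtain ⟨b, c, hb, hc, rfl⟩ := hR hf
    exact ⟨(b, c), by simpa [abs_le] using ⟨abs_le.1 hb, hc⟩, rfl⟩
  · rw [Finset.card_product, card_Icc_neg]; rfl

lemma ncard_le_of_subset_zeroRootRatio {N : ℕ} {R : Set ℤ[X]} (hR : R ⊆ zeroRootRatio N) :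
    R.ncard ≤ (2 * N + 1) * 10 := by
  refine (ncard_le_card_of_image (Finset.Icc (-(N : ℤ)) N ×ˢ (Finset.range 5 ×ˢ signs))
    (fun p => cub 0 (p.2.2 * Nat.sqrt (p.2.1 * p.1 : ℤ).natAbs) p.1) ?_).trans (le_of_eq ?_)
  · intro f hf
    obtain ⟨b, c, t, ht, hc, hb, rfl⟩ := hR hf
    obtain ⟨s, hs, hbs⟩ := eq_sign_mul_sqrt hb
    refine ⟨(c, t, s), ?_, by rw [← hbs]⟩
    simp only [Finset.mem_product, Finset.mem_Icc, Finset.mem_range]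
    exact ⟨abs_le.1 hc, ht, hs⟩
  · rw [Finset.card_product, Finset.card_product, card_Icc_neg, card_signs]; rfl

lemma ncard_le_of_subset_zeroRootSplit {N : ℕ} {R : Set ℤ[X]} (hR : R ⊆ zeroRootSplit N) :
    R.ncard ≤ (prodPairs N).card := by
  refine ncard_le_card_of_image _ (fun p => tri 0 p.1 p.2) ?_
  intro f hf
  obtain ⟨r, s, h0, h1, rfl⟩ := hR hf
  exact ⟨(r, s), mem_prodPairs.2 ⟨h0, h1⟩, rfl⟩

lemma ncard_le_of_subset_rootRatio {N : ℕ} {R : Set ℤ[X]} (hR : R ⊆ rootRatio N) :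
    R.ncard ≤ (prodPairs N).card * 10 := by
  refine (ncard_le_card_of_image (prodPairs N ×ˢ (Finset.range 5 ×ˢ signs))
    (fun p => cub p.1.1 (p.2.2 * Nat.sqrt (p.2.1 * p.1.2 : ℤ).natAbs) p.1.2) ?_).trans
    (le_of_eq ?_)
  · intro f hf
    obtain ⟨a, b, c, t, ht, h0, h1, hb, rfl⟩ := hR hf
    obtain ⟨s, hs, hbs⟩ := eq_sign_mul_sqrt hb
    refine ⟨((a, c), t, s), ?_, by rw [← hbs]⟩
    simp only [Finset.mem_product, Finset.mem_range]
    exact ⟨mem_prodPairs.2 ⟨h0, h1⟩, ht, hs⟩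
  · rw [Finset.card_product, Finset.card_product, card_signs]; rfl

/-- An interval bound for integers `b` with `c - a b` bounded. -/
lemma card_le_of_abs_sub_mul_le {N A : ℕ} {a c : ℤ} (hA : 1 ≤ A) (hAN : A ≤ N)
    (haA : a.natAbs = A) (B : Finset ℤ) (hB : ∀ b ∈ B, |c - a * b| ≤ N) :
    (B.card : ℝ) ≤ 3 * (N * (A : ℝ)⁻¹) := by
  have hA0 : (0 : ℝ) < A := by exact_mod_cast hA
  have hone : (1 : ℝ) ≤ N * (A : ℝ)⁻¹ := by
    rw [← div_eq_mul_inv, le_div_iff₀ hA0]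
    simpa using hAN
  rcases B.eq_empty_or_nonempty with rfl | hne
  · simp; positivity
  set m := B.min' hne
  have hm : m ∈ B := B.min'_mem hne
  have hsub : B ⊆ Finset.Icc m (m + (2 * N / A : ℕ)) := by
    intro b hb
    have hle : m ≤ b := B.min'_le b hb
    refine Finset.mem_Icc.2 ⟨hle, ?_⟩
    have h1 := abs_le.1 (hB b hb)
    have h2 := abs_le.1 (hB m hm)
    have h3 : |a * (b - m)| ≤ 2 * N := by
      rw [abs_le]; constructor <;> linarith [mul_sub a b m]
    rw [abs_mul, Int.abs_eq_natAbs, haA, abs_of_nonneg (sub_nonneg.2 hle)] at h3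
    have h4 : (b - m).toNat ≤ 2 * N / A := by
      rw [Nat.le_div_iff_mul_le (by omega)]
      zify
      rw [Int.toNat_of_nonneg (sub_nonneg.2 hle)]
      linarith
    omega
  have h5 := Finset.card_le_card hsub
  rw [Int.card_Icc] at h5
  have h6 : B.card ≤ 2 * N / A + 1 := by
    generalize 2 * N / A = k at h5 ⊢
    omega
  have h7 : ((2 * N / A : ℕ) : ℝ) ≤ (2 * N : ℕ) / (A : ℝ) := Nat.cast_div_le
  calc (B.card : ℝ) ≤ ((2 * N / A + 1 : ℕ) : ℝ) := by exact_mod_cast h6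
    _ = ((2 * N / A : ℕ) : ℝ) + 1 := by push_cast; ring
    _ ≤ 2 * (N * (A : ℝ)⁻¹) + N * (A : ℝ)⁻¹ := by
      refine add_le_add (h7.trans (le_of_eq ?_)) hone
      push_cast; ring
    _ = 3 * (N * (A : ℝ)⁻¹) := by ring

lemma sum_Icc_inv_pow_le {g : ℕ} (hg : 2 ≤ g) (n : ℕ) :
    ∑ i ∈ Finset.Icc 1 n, ((g : ℝ) ^ i)⁻¹ ≤ 2 * (g : ℝ)⁻¹ := by
  have hg' : (2 : ℝ) ≤ g := by exact_mod_cast hg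
  set r := (g : ℝ)⁻¹ with hr
  have hr0 : 0 ≤ r := by positivity
  have hr2 : 2 * r ≤ 1 := by
    rw [hr]
    field_simp
    exact hg'
  have key : ∑ i ∈ Finset.Icc 1 n, r ^ i ≤ 2 * r * (1 - r ^ n) := by
    induction n with
    | zero => simp
    | succ n ih =>
      rw [Finset.sum_Icc_succ_top (by omega)]
      have : 0 ≤ r ^ n * r := by positivity
      rw [pow_succ]
      nlinarith
  simp_rw [← inv_pow]
  refine key.trans ?_
  have : 0 ≤ r ^ n := by positivity
  nlinarith

lemma pow_pos_le_of_mul_le {A C N : ℕ} (hC : C ≠ 0) (h : A * C ≤ N) : A ≤ N :=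
  (Nat.le_mul_of_pos_right _ (Nat.pos_of_ne_zero hC)).trans h

lemma le_of_pow_le_of_two_le {g i N : ℕ} (hg : 2 ≤ g) (hi : 1 ≤ i) (h : g ^ i ≤ N) :
    g ≤ N ∧ i ≤ N :=
  ⟨(Nat.le_self_pow (by omega) g).trans h, (Nat.lt_pow_self (by omega)).le.trans h⟩

lemma ncard_le_of_subset_rootPower {N : ℕ} {R : Set ℤ[X]} (hR : R ⊆ rootPower N) :
    (R.ncard : ℝ) ≤
      ∑ g ∈ Finset.Icc 2 N, 24 * N * ((g : ℝ)⁻¹ * (Nat.log g N + 1)) := by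
  classical
  have h := ncard_le_sum_of_cover (E := R)
    ((Finset.Icc 2 N).sigma fun g =>
      Finset.Icc 1 N ×ˢ (Finset.range (Nat.log g N + 1) ×ˢ (signs ×ˢ signs)))
    (fun q => ((Finset.Icc (-(2 * N : ℤ)) (2 * N)).filter
      (fun b => q.1 ^ q.2.1 ≤ N ∧
        |q.2.2.2.2 * (q.1 ^ q.2.2.1 : ℕ) - q.2.2.2.1 * (q.1 ^ q.2.1 : ℕ) * b| ≤ N)).image
      (fun b => cub (q.2.2.2.1 * (q.1 ^ q.2.1 : ℕ)) b (q.2.2.2.2 * (q.1 ^ q.2.2.1 : ℕ))))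
    (fun q => 3 * (N * ((q.1 : ℝ) ^ q.2.1)⁻¹)) ?_ ?_
  · refine h.trans ?_
    rw [Finset.sum_sigma]
    refine Finset.sum_le_sum fun g hg => ?_
    have hg2 := (Finset.mem_Icc.1 hg).1
    rw [Finset.sum_product]
    simp only [Finset.sum_const, Finset.card_product, card_signs, Finset.card_range,
      nsmul_eq_mul]
    rw [← Finset.mul_sum, ← Finset.mul_sum, ← Finset.mul_sum]
    have := sum_Icc_inv_pow_le hg2 N
    calc _ ≤ (((Nat.log g N + 1) * (2 * 2) : ℕ) : ℝ) * (3 * (N * (2 * (g : ℝ)⁻¹))) := by gcongr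
      _ = _ := by push_cast; ring
  · intro f hf
    obtain ⟨a, b, c, g, i, j, hg, hi, hag, hcg, hac, hba, hcab, rfl⟩ := hR hf
    obtain ⟨s, hs, has⟩ := exists_sign_mul_natAbs a
    obtain ⟨t, ht, hct⟩ := exists_sign_mul_natAbs c
    rw [hag] at has
    rw [hcg] at hct
    rw [Int.abs_eq_natAbs, Nat.cast_le, Int.natAbs_mul, hag, hcg] at hac
    have hgi : g ^ i ≤ N := pow_pos_le_of_mul_le (pow_ne_zero _ (by omega)) hac
    have hgj : g ^ j ≤ N := pow_pos_le_of_mul_le (N := N) (A := g ^ j) (C := g ^ i)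
      (pow_ne_zero _ (by omega)) (by rwa [mul_comm])
    obtain ⟨hgN, hiN⟩ := le_of_pow_le_of_two_le hg hi hgi
    refine ⟨⟨g, i, j, s, t⟩, ?_, ?_⟩
    · simp only [Finset.mem_sigma, Finset.mem_product, Finset.mem_Icc, Finset.mem_range]
      have := Nat.le_log_of_pow_le (by omega) hgj
      exact ⟨⟨hg, hgN⟩, ⟨hi, hiN⟩, by omega, hs, ht⟩
    · refine Finset.mem_image.2 ⟨b, Finset.mem_filter.2 ⟨?_, hgi, ?_⟩, ?_⟩
      · have : a.natAbs ≤ N := hag ▸ hgi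
        rw [abs_le] at hba
        rw [Finset.mem_Icc]
        omega
      · dsimp only
        rw [← has, ← hct]; exact hcab
      · dsimp only
        rw [← has, ← hct]
  · rintro ⟨g, i, j, s, t⟩ hq
    simp only [Finset.mem_sigma, Finset.mem_product, Finset.mem_Icc, Finset.mem_range] at hq
    obtain ⟨⟨hg, -⟩, -, -, hs, -⟩ := hq
    refine (Nat.cast_le.2 Finset.card_image_le).trans ?_
    dsimp only
    by_cases hgi : g ^ i ≤ N
    · have hab : (s * ((g ^ i : ℕ) : ℤ)).natAbs = g ^ i := by
        rw [Int.natAbs_mul, Int.natAbs_natCast]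
        simp only [signs, Finset.mem_insert, Finset.mem_singleton] at hs
        rcases hs with rfl | rfl <;> simp
      have := card_le_of_abs_sub_mul_le (Nat.one_le_pow _ _ (by omega)) hgi hab
        ((Finset.Icc (-(2 * N : ℤ)) (2 * N)).filter (fun b => g ^ i ≤ N ∧
          |t * (g ^ j : ℕ) - s * (g ^ i : ℕ) * b| ≤ N))
        (fun b hb => (Finset.mem_filter.1 hb).2.2)
      simpa using this
    · simp only [hgi, false_and, Finset.filter_false, Finset.card_empty, Nat.cast_zero]
      positivity

lemma ncard_le_of_subset_splitPower {N : ℕ} {R : Set ℤ[X]} (hR : R ⊆ splitPower N) :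
    (R.ncard : ℝ) ≤ ∑ g ∈ Finset.Icc 2 N, 32 * N * (g : ℝ)⁻¹ := by
  classical
  have h := ncard_le_sum_of_cover (E := R)
    (Finset.Icc 2 N ×ˢ (Finset.Icc 1 N ×ˢ (Finset.Icc 1 N ×ˢ (signs ×ˢ signs))))
    (fun q => (signs ×ˢ Finset.Icc 1 (N / (q.1 ^ q.2.1 * q.1 ^ q.2.2.1))).image
      (fun r : ℤ × ℕ => tri (q.2.2.2.1 * (q.1 ^ q.2.1 : ℕ)) (q.2.2.2.2 * (q.1 ^ q.2.2.1 : ℕ))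
        (r.1 * (r.2 : ℤ))))
    (fun q => 2 * (N * (((q.1 : ℝ) ^ q.2.1)⁻¹ * ((q.1 : ℝ) ^ q.2.2.1)⁻¹))) ?_ ?_
  · refine h.trans ?_
    rw [Finset.sum_product]
    refine Finset.sum_le_sum fun g hg => ?_
    have hg2 := (Finset.mem_Icc.1 hg).1
    rw [Finset.sum_product]
    simp_rw [Finset.sum_product]
    simp only [Finset.sum_const, card_signs, nsmul_eq_mul, ← Finset.mul_sum]
    rw [← Finset.sum_mul]
    have h1 := sum_Icc_inv_pow_le hg2 N
    have h2 : (g : ℝ)⁻¹ ≤ 1 := inv_le_one_of_one_le₀ (by exact_mod_cast (by omega : 1 ≤ g))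
    have h0 : 0 ≤ ∑ i ∈ Finset.Icc 1 N, ((g : ℝ) ^ i)⁻¹ :=
      Finset.sum_nonneg fun i _ => by positivity
    have h3 : (∑ i ∈ Finset.Icc 1 N, ((g : ℝ) ^ i)⁻¹) * (∑ i ∈ Finset.Icc 1 N, ((g : ℝ) ^ i)⁻¹)
        ≤ (2 * (g : ℝ)⁻¹) * (2 * 1) := by
      gcongr
      exact h1.trans (by gcongr)
    have h4 : (0 : ℝ) ≤ N := by positivity
    have h5 := mul_le_mul_of_nonneg_left h3 h4
    push_cast
    linarith
  · intro f hf
    obtain ⟨x, y, z, g, i, j, hg, hi, hj, hx, hy, hz, hxyz, rfl⟩ := hR hf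
    obtain ⟨s, hs, hxs⟩ := exists_sign_mul_natAbs x
    obtain ⟨t, ht, hyt⟩ := exists_sign_mul_natAbs y
    obtain ⟨u, hu, hzu⟩ := exists_sign_mul_natAbs z
    rw [hx] at hxs
    rw [hy] at hyt
    have hz0 : 0 < z.natAbs := Int.natAbs_pos.2 hz
    rw [Int.abs_eq_natAbs, Nat.cast_le, Int.natAbs_mul, Int.natAbs_mul, hx, hy] at hxyz
    have hij : g ^ i * g ^ j ≤ N := pow_pos_le_of_mul_le hz0.ne' hxyz
    obtain ⟨hgN, hiN⟩ := le_of_pow_le_of_two_le hg hi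
      (pow_pos_le_of_mul_le (pow_ne_zero _ (by omega)) hij)
    obtain ⟨-, hjN⟩ := le_of_pow_le_of_two_le hg hj
      (pow_pos_le_of_mul_le (N := N) (A := g ^ j) (C := g ^ i) (pow_ne_zero _ (by omega))
        (by rwa [mul_comm]))
    refine ⟨⟨g, i, j, s, t⟩, ?_, ?_⟩
    · simp only [Finset.mem_product, Finset.mem_Icc]
      exact ⟨⟨hg, hgN⟩, ⟨hi, hiN⟩, ⟨hj, hjN⟩, hs, ht⟩
    · refine Finset.mem_image.2 ⟨(u, z.natAbs), ?_, ?_⟩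
      · simp only [Finset.mem_product, Finset.mem_Icc]
        refine ⟨hu, hz0, (Nat.le_div_iff_mul_le (by positivity)).2 (by rwa [mul_comm])⟩
      · dsimp only
        rw [← hxs, ← hyt, ← hzu]
  · rintro ⟨g, i, j, s, t⟩ -
    refine (Nat.cast_le.2 Finset.card_image_le).trans ?_
    rw [Finset.card_product, card_signs, Nat.card_Icc, Nat.add_sub_cancel]
    dsimp only
    have : ((N / (g ^ i * g ^ j) : ℕ) : ℝ) ≤ (N : ℝ) / ((g ^ i * g ^ j : ℕ) : ℝ) :=
      Nat.cast_div_le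
    push_cast at this ⊢
    rw [← mul_inv, ← div_eq_mul_inv]
    linarith

lemma ncard_le_of_subset_splitIndep {N : ℕ} {R : Set ℤ[X]} (hR : R ⊆ splitIndep N) :
    (R.ncard : ℝ) ≤
      4 * ((N : ℝ) ^ (2 / 3 : ℝ) * (1 + Real.log N)) * (2 * (Nat.log 2 N + 1) ^ 2) := by
  classical
  set K := ⌊(N : ℝ) ^ (2 / 3 : ℝ)⌋₊ with hK
  have hKle : (K : ℝ) ≤ (N : ℝ) ^ (2 / 3 : ℝ) := Nat.floor_le (by positivity)
  have h := ncard_le_sum_of_cover (E := R)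
    ((prodPairs K).filter fun p => ValIndep p.1.natAbs p.2.natAbs)
    (fun p => (depSet N p.1.natAbs p.2.natAbs).image (fun z => tri p.1 p.2 z))
    (fun _ => 2 * ((Nat.log 2 N : ℝ) + 1) ^ 2) ?_ ?_
  · refine h.trans ?_
    rw [Finset.sum_const, nsmul_eq_mul]
    have h1 : ((((prodPairs K).filter fun p => ValIndep p.1.natAbs p.2.natAbs).card : ℕ) : ℝ)
        ≤ (prodPairs K).card := by exact_mod_cast Finset.card_filter_le _ _
    have h2 := card_prodPairs_le K
    rcases Nat.eq_zero_or_pos N with rfl | hN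
    · have hK0 : K = 0 := by simp [hK]
      rw [hK0] at h1 h2 ⊢
      simp at h2
      simp [h2]
    have hN1 : (1 : ℝ) ≤ N := by exact_mod_cast hN
    have hK1 : 1 ≤ K := by
      rw [hK, Nat.one_le_floor_iff]
      exact Real.one_le_rpow hN1 (by norm_num)
    have hKN : (K : ℝ) ≤ N := hKle.trans (by
      conv_rhs => rw [← Real.rpow_one (N : ℝ)]
      exact Real.rpow_le_rpow_of_exponent_le hN1 (by norm_num))
    have hlog : Real.log K ≤ Real.log N := Real.log_le_log (by exact_mod_cast hK1) hKN
    have hlog0 : 0 ≤ Real.log K := Real.log_nonneg (by exact_mod_cast hK1)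
    gcongr
    refine h1.trans (h2.trans ?_)
    gcongr
  · intro f hf
    obtain ⟨x, y, z, hxy, -, hpow, hind, hz, rfl⟩ := hR hf
    refine ⟨(x, y), Finset.mem_filter.2 ⟨mem_prodPairs.2 ⟨hxy, ?_⟩, hind⟩,
      Finset.mem_image.2 ⟨z, hz, rfl⟩⟩
    rw [Int.abs_eq_natAbs, Nat.cast_le, hK]
    apply Nat.le_floor
    have h3 : (((x * y).natAbs : ℝ)) ^ (3 : ℝ) ≤ (N : ℝ) ^ (2 : ℝ) := by
      rw [show (3 : ℝ) = ((3 : ℕ) : ℝ) by norm_num, show (2 : ℝ) = ((2 : ℕ) : ℝ) by norm_num,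
        Real.rpow_natCast, Real.rpow_natCast]
      exact_mod_cast hpow
    have h4 := Real.rpow_le_rpow (by positivity) h3 (by norm_num : (0 : ℝ) ≤ 1 / 3)
    rw [← Real.rpow_mul (by positivity), ← Real.rpow_mul (by positivity)] at h4
    norm_num at h4
    simpa using h4
  · rintro ⟨x, y⟩ hp
    refine (Nat.cast_le.2 Finset.card_image_le).trans ?_
    exact_mod_cast card_depSet_le (N := N) (Finset.mem_filter.1 hp).2

lemma sum_inv_mul_log_le {n : ℕ} (hn : 3 ≤ n) :
    ∑ g ∈ Finset.Icc 2 n, (g : ℝ)⁻¹ * (Real.log g)⁻¹ ≤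
      2⁻¹ * (Real.log 2)⁻¹ + 3⁻¹ * (Real.log 3)⁻¹ + (Real.log (Real.log n)
        - Real.log (Real.log 3)) := by
  induction n, hn using Nat.le_induction with
  | base =>
    rw [show Finset.Icc 2 3 = {2, 3} from rfl, Finset.sum_pair (by norm_num)]
    simp
  | succ n hn ih =>
    rw [Finset.sum_Icc_succ_top (by omega)]
    have hn3 : (3 : ℝ) ≤ n := by exact_mod_cast hn
    have l0 : 0 < Real.log n := Real.log_pos (by linarith)
    have l1 : 0 < Real.log ((n + 1 : ℕ) : ℝ) := Real.log_pos (by push_cast; linarith)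
    have h1 := Real.one_sub_inv_le_log_of_pos (div_pos l1 l0)
    rw [Real.log_div l1.ne' l0.ne', inv_div] at h1
    have hn1 : (0 : ℝ) < ((n + 1 : ℕ) : ℝ) := by positivity
    have hn0 : (0 : ℝ) < n := by linarith
    have h2 := Real.one_sub_inv_le_log_of_pos (div_pos hn1 hn0)
    rw [Real.log_div hn1.ne' hn0.ne', inv_div] at h2
    have h3 : (1 : ℝ) - n / ((n + 1 : ℕ) : ℝ) = ((n + 1 : ℕ) : ℝ)⁻¹ := by
      push_cast; field_simp; ring
    rw [h3] at h2
    have h4 : ((n + 1 : ℕ) : ℝ)⁻¹ * (Real.log ((n + 1 : ℕ) : ℝ))⁻¹ ≤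
        1 - Real.log n / Real.log ((n + 1 : ℕ) : ℝ) := by
      rw [← div_eq_mul_inv, div_le_iff₀ l1, sub_mul, div_mul_cancel₀ _ l1.ne', one_mul]
      exact h2
    linarith

lemma natLog_add_one_le {g N : ℕ} (hg : 2 ≤ g) (hgN : g ≤ N) :
    (Nat.log g N : ℝ) + 1 ≤ 2 * (Real.log N * (Real.log g)⁻¹) := by
  have h1 : (Nat.log g N : ℝ) ≤ Real.log N * (Real.log g)⁻¹ := by
    have := Real.natLog_le_logb N g
    rwa [Real.logb, div_eq_mul_inv] at this
  have hg' : (2 : ℝ) ≤ g := by exact_mod_cast hg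
  have l0 : 0 < Real.log g := Real.log_pos (by linarith)
  have h2 : (1 : ℝ) ≤ Real.log N * (Real.log g)⁻¹ := by
    rw [← div_eq_mul_inv, le_div_iff₀ l0, one_mul]
    exact Real.log_le_log (by linarith) (by exact_mod_cast hgN)
  linarith

lemma sum_Icc_two_inv_le (N : ℕ) :
    ∑ g ∈ Finset.Icc 2 N, (g : ℝ)⁻¹ ≤ 1 + Real.log N := by
  have := harmonic_le_one_add_log N
  rw [harmonic_eq_sum_Icc] at this
  push_cast at this
  refine le_trans (Finset.sum_le_sum_of_subset_of_nonneg ?_ fun _ _ _ => by positivity) this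
  exact Finset.Icc_subset_Icc_left (by norm_num)

lemma one_le_log {N : ℕ} (hN : 3 ≤ N) : 1 ≤ Real.log N := by
  rw [Real.le_log_iff_exp_le (by positivity)]
  have : (3 : ℝ) ≤ N := by exact_mod_cast hN
  linarith [Real.exp_one_lt_d9]

lemma rpow_mul_log_cube_le {N : ℕ} (hN : 3 ≤ N) :
    (N : ℝ) ^ (2 / 3 : ℝ) * Real.log N ^ 3 ≤ 36 * (N * Real.log N) := by
  have hN0 : (0 : ℝ) < N := by positivity
  have h1 := Real.log_le_rpow_div hN0.le (by norm_num : (0 : ℝ) < 1 / 6)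
  have h2 : Real.log N ≤ 6 * (N : ℝ) ^ (1 / 6 : ℝ) := by linarith
  have hl := one_le_log hN
  have h3 : Real.log N ^ 2 ≤ 36 * (N : ℝ) ^ (1 / 3 : ℝ) := by
    calc Real.log N ^ 2 ≤ (6 * (N : ℝ) ^ (1 / 6 : ℝ)) ^ 2 := by gcongr
      _ = 36 * ((N : ℝ) ^ (1 / 6 : ℝ) * (N : ℝ) ^ (1 / 6 : ℝ)) := by ring
      _ = 36 * (N : ℝ) ^ (1 / 3 : ℝ) := by rw [← Real.rpow_add hN0]; norm_num
  calc (N : ℝ) ^ (2 / 3 : ℝ) * Real.log N ^ 3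
      = (N : ℝ) ^ (2 / 3 : ℝ) * Real.log N ^ 2 * Real.log N := by ring
    _ ≤ (N : ℝ) ^ (2 / 3 : ℝ) * (36 * (N : ℝ) ^ (1 / 3 : ℝ)) * Real.log N := by gcongr
    _ = 36 * (((N : ℝ) ^ (2 / 3 : ℝ) * (N : ℝ) ^ (1 / 3 : ℝ)) * Real.log N) := by ring
    _ = 36 * (N * Real.log N) := by rw [← Real.rpow_add hN0]; norm_num

lemma ncard_le_of_subset_exceptional {N : ℕ} (hN : 3 ≤ N) {R : Set ℤ[X]}
    (hR : R ⊆ exceptional N) :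
    (R.ncard : ℝ) ≤ N * Real.log N * (5375 + 48 * (2⁻¹ * (Real.log 2)⁻¹
      + 3⁻¹ * (Real.log 3)⁻¹ + (Real.log (Real.log N) - Real.log (Real.log 3)))) := by
  have hl := one_le_log hN
  have hN3 : (3 : ℝ) ≤ N := by exact_mod_cast hN
  set L := Real.log N with hL
  have hNL : (N : ℝ) ≤ N * L := le_mul_of_one_le_right (by linarith) hl
  have hsub : ∀ S : Set ℤ[X], R ∩ S ⊆ S := fun S => Set.inter_subset_right
  have b1 : ((R ∩ zeroRootSmall N).ncard : ℝ) ≤ (2 * N + 1) * 3 := by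
    exact_mod_cast ncard_le_of_subset_zeroRootSmall (hsub _)
  have b2 : ((R ∩ zeroRootRatio N).ncard : ℝ) ≤ (2 * N + 1) * 10 := by
    exact_mod_cast ncard_le_of_subset_zeroRootRatio (hsub _)
  have b3 : ((R ∩ zeroRootSplit N).ncard : ℝ) ≤ (prodPairs N).card := by
    exact_mod_cast ncard_le_of_subset_zeroRootSplit (hsub _)
  have b4 : ((R ∩ rootRatio N).ncard : ℝ) ≤ (prodPairs N).card * 10 := by
    exact_mod_cast ncard_le_of_subset_rootRatio (hsub _)
  have b5 : ((R ∩ rootPower N).ncard : ℝ) ≤ 48 * (N * L) * (2⁻¹ * (Real.log 2)⁻¹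
      + 3⁻¹ * (Real.log 3)⁻¹ + (Real.log L - Real.log (Real.log 3))) := by
    refine (ncard_le_of_subset_rootPower (hsub _)).trans ?_
    calc _ ≤ ∑ g ∈ Finset.Icc 2 N, 48 * (N * L) * ((g : ℝ)⁻¹ * (Real.log g)⁻¹) := by
          refine Finset.sum_le_sum fun g hg => ?_
          obtain ⟨hg2, hgN⟩ := Finset.mem_Icc.1 hg
          calc _ ≤ 24 * N * ((g : ℝ)⁻¹ * (2 * (L * (Real.log g)⁻¹))) := by
                gcongr
                exact natLog_add_one_le hg2 hgN
            _ = _ := by ring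
      _ ≤ _ := by
          rw [← Finset.mul_sum]
          gcongr
          exact sum_inv_mul_log_le hN
  have b6 : ((R ∩ splitPower N).ncard : ℝ) ≤ 64 * (N * L) := by
    refine (ncard_le_of_subset_splitPower (hsub _)).trans ?_
    rw [← Finset.mul_sum]
    have := sum_Icc_two_inv_le N
    calc _ ≤ 32 * (N : ℝ) * (1 + L) := by gcongr
      _ ≤ _ := by linarith
  have b7 : ((R ∩ splitIndep N).ncard : ℝ) ≤ 5184 * (N * L) := by
    refine (ncard_le_of_subset_splitIndep (hsub _)).trans ?_
    have h1 : (Nat.log 2 N : ℝ) + 1 ≤ 3 * L := by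
      have h2 := natLog_add_one_le (g := 2) (N := N) (by norm_num) (by omega)
      have h3 : (Real.log 2)⁻¹ ≤ 3 / 2 := by
        rw [inv_le_comm₀ (Real.log_pos (by norm_num)) (by norm_num)]
        linarith [Real.log_two_gt_d9]
      have h4 : L * (Real.log 2)⁻¹ ≤ L * (3 / 2) := by gcongr
      push_cast at h2
      linarith
    calc _ ≤ 4 * ((N : ℝ) ^ (2 / 3 : ℝ) * (L + L)) * (2 * (3 * L) ^ 2) := by gcongr
      _ = 144 * ((N : ℝ) ^ (2 / 3 : ℝ) * L ^ 3) := by ring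
      _ ≤ _ := by linarith [rpow_mul_log_cube_le hN]
  have b0 : (R.ncard : ℝ) ≤ (R ∩ zeroRootSmall N).ncard + (R ∩ zeroRootRatio N).ncard
      + (R ∩ zeroRootSplit N).ncard + (R ∩ rootRatio N).ncard + (R ∩ rootPower N).ncard
      + (R ∩ splitPower N).ncard + (R ∩ splitIndep N).ncard := by
    have e : R = R ∩ exceptional N := (Set.inter_eq_left.2 hR).symm
    rw [exceptional] at e
    simp only [Set.inter_union_distrib_left] at e
    have h : R.ncard ≤ (R ∩ zeroRootSmall N).ncard + (R ∩ zeroRootRatio N).ncard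
      + (R ∩ zeroRootSplit N).ncard + (R ∩ rootRatio N).ncard + (R ∩ rootPower N).ncard
      + (R ∩ splitPower N).ncard + (R ∩ splitIndep N).ncard := by
      conv_lhs => rw [e]
      iterate 5 refine (Set.ncard_union_le _ _).trans (Nat.add_le_add_right ?_ _)
      exact Set.ncard_union_le _ _
    exact_mod_cast h
  have hp := card_prodPairs_le N
  linarith

lemma sum_abs_add_one (n : ℕ) :
    ∑ A ∈ Finset.Icc (-(n : ℤ)) n, |A + 1| = (n : ℤ) ^ 2 + n + 1 := by
  induction n with
  | zero => simp
  | succ n ih =>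
    have e : Finset.Icc (-((n + 1 : ℕ) : ℤ)) ((n + 1 : ℕ) : ℤ) =
        insert (-((n : ℤ) + 1)) (insert ((n : ℤ) + 1) (Finset.Icc (-(n : ℤ)) n)) := by
      ext x
      simp only [Finset.mem_insert, Finset.mem_Icc]
      omega
    rw [e, Finset.sum_insert, Finset.sum_insert, ih]
    · rw [abs_of_nonneg (by omega : (0 : ℤ) ≤ (n : ℤ) + 1 + 1),
        abs_of_nonpos (by omega : -((n : ℤ) + 1) + 1 ≤ 0)]
      push_cast; ring
    · simp
    · simp only [Finset.mem_insert, Finset.mem_Icc]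
      omega

/-- Pairs `(A, B)` with `|A|, |B|, |1 + A + B| ≤ N`. -/
noncomputable def boxPairs (N : ℕ) : Finset (ℤ × ℤ) :=
  (Finset.Icc (-(N : ℤ)) N ×ˢ Finset.Icc (-(N : ℤ)) N).filter (fun p => |1 + p.1 + p.2| ≤ N)

lemma card_boxPairs (N : ℕ) : (boxPairs N).card = 3 * N ^ 2 + 3 * N := by
  have h : ((boxPairs N).card : ℤ) =
      ∑ A ∈ Finset.Icc (-(N : ℤ)) N, (2 * (N : ℤ) + 1 - |A + 1|) := by
    rw [boxPairs, Finset.card_filter, Finset.sum_product]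
    push_cast
    refine Finset.sum_congr rfl fun A hA => ?_
    rw [Finset.mem_Icc] at hA
    rw [← Finset.natCast_card_filter]
    have e : (Finset.Icc (-(N : ℤ)) N).filter (fun B => |1 + A + B| ≤ N) =
        Finset.Icc (max (-(N : ℤ)) (-N - 1 - A)) (min (N : ℤ) (N - 1 - A)) := by
      ext B
      simp only [Finset.mem_filter, Finset.mem_Icc, abs_le]
      omega
    rw [e, Int.card_Icc]
    rcases abs_cases (A + 1) with ⟨h, h0⟩ | ⟨h, h0⟩
    · rw [h, max_eq_left (by omega), min_eq_right (by omega)]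
      omega
    · rw [h, max_eq_right (by omega), min_eq_left (by omega)]
      omega
  rw [Finset.sum_sub_distrib, sum_abs_add_one, Finset.sum_const, card_Icc_neg] at h
  zify
  rw [h, nsmul_eq_mul]
  push_cast; ring

/-- For `e = ±1`, the monic cubic with root `e` parametrised by two of its coefficients. -/
noncomputable def unitRootCubic (e : ℤ) (p : ℤ × ℤ) : ℤ[X] :=
  X ^ 3 + C (e * p.1) * X ^ 2 + C p.2 * X + C (-e * (1 + p.1 + p.2))

lemma coeff_unitRootCubic (e : ℤ) (p : ℤ × ℤ) :
    (unitRootCubic e p).coeff 0 = -e * (1 + p.1 + p.2) ∧ (unitRootCubic e p).coeff 1 = p.2 ∧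
      (unitRootCubic e p).coeff 2 = e * p.1 := by
  refine ⟨?_, ?_, ?_⟩ <;>
  simp [unitRootCubic, coeff_X_pow, coeff_X, coeff_C, -eq_intCast, -map_mul, -map_neg, -map_add]

lemma monic_cubic (a b c : ℤ) : (X ^ 3 + C a * X ^ 2 + C b * X + C c).Monic := by
  monicity!

lemma natDegree_cubic_eq (a b c : ℤ) :
    (X ^ 3 + C a * X ^ 2 + C b * X + C c).natDegree = 3 := by
  compute_degree!

lemma eq_cubic_of_monic {f : ℤ[X]} (hf : f.Monic) (hd : f.natDegree = 3) :
    f = X ^ 3 + C (f.coeff 2) * X ^ 2 + C (f.coeff 1) * X + C (f.coeff 0) := by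
  have h3 : f.coeff 3 = 1 := by rw [← hd]; exact hf
  conv_lhs => rw [f.as_sum_range_C_mul_X_pow, hd]
  simp [Finset.sum_range_succ, h3]
  ring

lemma injective_unitRootCubic {e : ℤ} (he : e = 1 ∨ e = -1) :
    Function.Injective (unitRootCubic e) := by
  rintro ⟨A, B⟩ ⟨A', B'⟩ h
  obtain ⟨-, h1, h2⟩ := coeff_unitRootCubic e (A, B)
  obtain ⟨-, h1', h2'⟩ := coeff_unitRootCubic e (A', B')
  rw [h] at h1 h2
  have e1 := h1.symm.trans h1'
  have e2 := h2.symm.trans h2'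
  rcases he with rfl | rfl <;> simp_all

/-- The monic cubics of height at most `N` with root `e`, for `e = ±1`. -/
noncomputable def unitRootSet (e : ℤ) (N : ℕ) : Set ℤ[X] := unitRootCubic e '' boxPairs N

lemma ncard_unitRootSet {e : ℤ} (he : e = 1 ∨ e = -1) (N : ℕ) :
    (unitRootSet e N).ncard = 3 * N ^ 2 + 3 * N := by
  rw [unitRootSet, Set.ncard_image_of_injective _ (injective_unitRootCubic he),
    Set.ncard_coe_finset, card_boxPairs]

lemma mem_boxPairs {N : ℕ} {A B : ℤ} :
    (A, B) ∈ boxPairs N ↔ |A| ≤ N ∧ |B| ≤ N ∧ |1 + A + B| ≤ N := by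
  simp only [boxPairs, Finset.mem_filter, Finset.mem_product, Finset.mem_Icc, abs_le]
  tauto

lemma unitRootSet_subset_Rset {e : ℤ} (he : e = 1 ∨ e = -1) {N : ℕ} (hN : 3 ≤ N) :
    unitRootSet e N ⊆ Rset 3 N := by
  rintro f ⟨⟨A, B⟩, hp, rfl⟩
  rw [Finset.mem_coe, mem_boxPairs] at hp
  have hm : (unitRootCubic e (A, B)).Monic := monic_cubic _ _ _
  have hd : (unitRootCubic e (A, B)).natDegree = 3 := natDegree_cubic_eq _ _ _
  have hev : (unitRootCubic e (A, B)).eval e = 0 := by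
    rcases he with rfl | rfl
    · simp [unitRootCubic]
    · simp [unitRootCubic]
      ring
  have hae : |e| = 1 := by rcases he with rfl | rfl <;> rfl
  obtain ⟨h0, h1, h2⟩ := coeff_unitRootCubic e (A, B)
  refine ⟨hm, hd, ?_, ?_, genDeg_of_eval_eq_zero hm hd he hev⟩
  · intro i
    match i with
    | 0 => rw [h0, abs_mul, abs_neg, hae, one_mul]; exact hp.2.2
    | 1 => rw [h1]; exact hp.2.1
    | 2 => rw [h2, abs_mul, hae, one_mul]; exact hp.1
    | 3 =>
      have : (unitRootCubic e (A, B)).coeff 3 = 1 := by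
        have := hm.coeff_natDegree; rwa [hd] at this
      rw [this, abs_one]; omega
    | k + 4 =>
      rw [coeff_eq_zero_of_natDegree_lt (by omega), abs_zero]
      omega
  · rw [hm.irreducible_iff_roots_eq_zero_of_degree_le_three (by omega) (by omega)]
    intro h
    have : e ∈ (unitRootCubic e (A, B)).roots := (mem_roots hm.ne_zero).2 hev
    rw [h] at this
    simp at this

lemma mem_unitRootSet_of_eval {e : ℤ} (he : e = 1 ∨ e = -1) {N : ℕ} {f : ℤ[X]}
    (hf : f ∈ Rset 3 N) (hev : f.eval e = 0) : f ∈ unitRootSet e N := by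
  obtain ⟨hm, hd, hH, -, -⟩ := hf
  have hfe := eq_cubic_of_monic hm hd
  have k0 := hH 0
  have k1 := hH 1
  have k2 := hH 2
  rw [hfe] at hev
  simp only [eval_add, eval_mul, eval_pow, eval_X, eval_C] at hev
  have h0 : f.coeff 0 = -e * (1 + e * f.coeff 2 + f.coeff 1) := by
    rcases he with rfl | rfl <;> linarith
  have hae : |e| = 1 := by rcases he with rfl | rfl <;> rfl
  have hee : e * e = 1 := by rcases he with rfl | rfl <;> rfl
  refine ⟨(e * f.coeff 2, f.coeff 1), ?_, ?_⟩
  · rw [Finset.mem_coe, mem_boxPairs, abs_mul, hae, one_mul]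
    refine ⟨k2, k1, ?_⟩
    rwa [h0, abs_mul, abs_neg, hae, one_mul] at k0
  · rw [unitRootCubic]
    dsimp only
    rw [← h0, ← mul_assoc, hee, one_mul]
    exact hfe.symm

lemma ncard_inter_unitRootSet_le (N : ℕ) :
    (unitRootSet 1 N ∩ unitRootSet (-1) N).ncard ≤ 2 * N + 1 := by
  rw [← card_Icc_neg]
  refine ncard_le_card_of_image _ (fun A => unitRootCubic 1 (A, -1)) ?_
  rintro f ⟨⟨⟨A, B⟩, hp, rfl⟩, ⟨⟨A', B'⟩, -, h⟩⟩
  rw [Finset.mem_coe, mem_boxPairs] at hp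
  obtain ⟨h0, h1, h2⟩ := coeff_unitRootCubic 1 (A, B)
  obtain ⟨h0', h1', h2'⟩ := coeff_unitRootCubic (-1) (A', B')
  rw [h] at h0' h1' h2'
  rw [h0] at h0'
  rw [h1] at h1'
  rw [h2] at h2'
  dsimp only at h0' h1' h2'
  obtain rfl : B = -1 := by linarith
  exact ⟨A, Finset.mem_Icc.2 (abs_le.1 hp.1), rfl⟩

lemma finite_Rset (N : ℕ) : (Rset 3 N).Finite := by
  refine ((Finset.finite_toSet (Finset.Icc (-(N : ℤ)) N ×ˢ Finset.Icc (-(N : ℤ)) N ×ˢ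
    Finset.Icc (-(N : ℤ)) N)).image (fun q : ℤ × ℤ × ℤ =>
      (X ^ 3 + C q.1 * X ^ 2 + C q.2.1 * X + C q.2.2 : ℤ[X]))).subset ?_
  rintro f ⟨hm, hd, hH, -, -⟩
  refine ⟨(f.coeff 2, f.coeff 1, f.coeff 0), ?_, (eq_cubic_of_monic hm hd).symm⟩
  simp only [Finset.mem_coe, Finset.mem_product, Finset.mem_Icc]
  exact ⟨abs_le.1 (hH 2), abs_le.1 (hH 1), abs_le.1 (hH 0)⟩

theorem stmt_5 :
    ∃ C : ℝ, 0 < C ∧ ∀ H : ℤ, 3 ≤ H →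
      |((Rset 3 H).ncard : ℝ) - 6 * (H : ℝ) ^ 2| ≤
        C * (H : ℝ) * Real.log H * Real.log (Real.log H) := by
  have hlog3 : 1 < Real.log 3 := by
    rw [Real.lt_log_iff_exp_lt (by norm_num)]
    linarith [Real.exp_one_lt_d9]
  set μ := Real.log (Real.log 3) with hμ
  have hμ0 : 0 < μ := Real.log_pos hlog3
  set K := 2⁻¹ * (Real.log 2)⁻¹ + 3⁻¹ * (Real.log 3)⁻¹ with hK
  have hlog2 : 0 < Real.log 2 := Real.log_pos (by norm_num)
  have hK0 : 0 ≤ K := by positivity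
  refine ⟨(5381 + 48 * K) / μ + 48, by positivity, fun H hH => ?_⟩
  lift H to ℕ using by omega
  have hN : 3 ≤ H := by exact_mod_cast hH
  rename ℕ => N
  have hN3 : (3 : ℝ) ≤ N := by exact_mod_cast hN
  have hl := one_le_log hN
  set L := Real.log N with hL
  have hM : μ ≤ Real.log L := Real.log_le_log (by linarith)
    (Real.log_le_log (by norm_num) hN3)
  have hNL : (N : ℝ) ≤ N * L := le_mul_of_one_le_right (by linarith) hl
  set U := unitRootSet 1 N ∪ unitRootSet (-1) N with hU
  have hUsub : U ⊆ Rset 3 N := Set.union_subset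
    (unitRootSet_subset_Rset (Or.inl rfl) hN) (unitRootSet_subset_Rset (Or.inr rfl) hN)
  have hfin := finite_Rset N
  have hUcard := Set.ncard_union_add_ncard_inter (unitRootSet 1 N) (unitRootSet (-1) N)
    (hfin.subset (unitRootSet_subset_Rset (Or.inl rfl) hN))
    (hfin.subset (unitRootSet_subset_Rset (Or.inr rfl) hN))
  rw [← hU, ncard_unitRootSet (Or.inl rfl), ncard_unitRootSet (Or.inr rfl)] at hUcard
  have hinter := ncard_inter_unitRootSet_le N
  have hlow : 6 * N ^ 2 ≤ (Rset 3 N).ncard := by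
    have := Set.ncard_le_ncard hUsub hfin
    omega
  have hdiff := Set.ncard_sdiff_add_ncard_of_subset hUsub hfin
  have hexc := ncard_le_of_subset_exceptional hN (R := Rset 3 N \ U) (by
    rintro f ⟨hf, hfU⟩
    refine mem_exceptional_of_mem_Rset hf (fun h => hfU ?_) (fun h => hfU ?_)
    · exact Or.inl (mem_unitRootSet_of_eval (Or.inl rfl) hf h)
    · exact Or.inr (mem_unitRootSet_of_eval (Or.inr rfl) hf h))
  have hup : ((Rset 3 N).ncard : ℝ) ≤ ((Rset 3 N \ U).ncard : ℝ) + (6 * (N : ℝ) ^ 2 + 6 * N) := by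
    have : (Rset 3 N).ncard ≤ (Rset 3 N \ U).ncard + (6 * N ^ 2 + 6 * N) := by omega
    exact_mod_cast this
  have hlow' : 6 * (N : ℝ) ^ 2 ≤ ((Rset 3 N).ncard : ℝ) := by exact_mod_cast hlow
  rw [Int.cast_natCast, abs_of_nonneg (by linarith)]
  have hone : 1 ≤ Real.log L / μ := (one_le_div hμ0).2 hM
  have hNL0 : 0 ≤ N * L := by linarith
  calc ((Rset 3 N).ncard : ℝ) - 6 * (N : ℝ) ^ 2
      ≤ N * L * (5381 + 48 * K + 48 * Real.log L) := by
        rw [← hL, ← hK, ← hμ] at hexc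
        have h0 : 0 ≤ N * L * μ := by positivity
        have e : N * L * (5375 + 48 * (K + (Real.log L - μ))) + 6 * (N * L) =
          N * L * (5381 + 48 * K + 48 * Real.log L) - 48 * (N * L * μ) := by ring
        linarith
    _ ≤ N * L * ((5381 + 48 * K) * (Real.log L / μ) + 48 * Real.log L) := by
        gcongr
        exact le_mul_of_one_le_right (by positivity) hone
    _ = _ := by ring
end
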